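/- Let u(x,t) = u_0(x − t) with u_0 : ℝ → ℝ of class C^{2k+2}, let u_h be a DG solution on [0,T] (with either the periodic upwind flux, u_0 being 2π-periodic, or the Dirichlet inflow flux), and suppose the initial error satisfies ‖u_h(·,0) − u_I^k(·,0)‖_0 ≤ C₀ h^{2k+1} M_{2k+2}. Then there is a constant C depending only on k, C₀ and the quasi-uniformity constant c such that for all j = 1,…,N and all t ∈ [0,T]: |(u − u_h)(x_{j+1/2}^-, t)| ≤ C (1+t) h^{2k+1/2} M_{2k+2}, and ( (1/N) Σ_{j=1}^N ((u − u_h)(x_{j+1/2}^-, t))² )^{1/2} ≤ C (1+t) h^{2k+1} M_{2k+2}, where (u − u_h)(x_{j+1/2}^-, t) = u(x_{j+1/2},t) − u_h(x_{j+1/2}^-,t). -/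

import Mathlib

open MeasureTheory intervalIntegral

/-- Legendre polynomial of degree `m` via the Rodrigues formula. -/
noncomputable def legendreP (m : ℕ) : ℝ → ℝ :=
  fun s => (1 / ((2:ℝ) ^ m * (Nat.factorial m : ℝ))) *
    iteratedDeriv m (fun t : ℝ => (t ^ 2 - 1) ^ m) s

/-- Legendre polynomial rescaled to the cell `(a, b)`. -/
noncomputable def legendreCell (m : ℕ) (a b : ℝ) : ℝ → ℝ :=
  fun x => legendreP m ((2 * x - (a + b)) / (b - a))

/-- `P` is the Gauss–Radau projection (onto polynomials of degree ≤ k on `(a,b)`) of `u`. -/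
def IsGRProj (k : ℕ) (a b : ℝ) (u : ℝ → ℝ) (P : Polynomial ℝ) : Prop :=
  P.natDegree ≤ k ∧
  (∀ v : Polynomial ℝ, v.natDegree + 1 ≤ k →
    (∫ x in a..b, P.eval x * v.eval x) = ∫ x in a..b, u x * v.eval x) ∧
  P.eval b = u b

/-- The scaled primitive `(D⁻¹ v)(x) = (2/(b-a)) ∫_a^x v`. -/
noncomputable def Dinv (a b : ℝ) (v : ℝ → ℝ) : ℝ → ℝ :=
  fun x => (2 / (b - a)) * ∫ t in a..x, v t

/-- `F` is the sequence of correction polynomials on the cell `(a,b)`: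
`F 1 = P_h^-(D⁻¹ L_k)` and `F i = -P_h^-(D⁻¹ F (i-1))` for `i ≥ 2`. -/
def IsFSeq (k : ℕ) (a b : ℝ) (F : ℕ → Polynomial ℝ) : Prop :=
  IsGRProj k a b (Dinv a b (legendreCell k a b)) (F 1) ∧
  ∀ i, 2 ≤ i → IsGRProj k a b (Dinv a b (fun x => (F (i-1)).eval x)) (-(F i))

/-- The `m`-th Radau coefficient of `w` on the cell `(a,b)`. -/
noncomputable def radauCoeff (a b : ℝ) (w : ℝ → ℝ) (m : ℕ) : ℝ :=
  w b - (1 / (b - a)) *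
    ∫ x in a..b, w x * ∑ l ∈ Finset.range m, (2 * (l:ℝ) + 1) * legendreCell l a b x

/-- `G_i(t) = (d/dt)^i u_{j,k+1}(t)` for `u(x,t) = u0(x - t)` on the cell `(a,b)`. -/
noncomputable def Gfun (k : ℕ) (a b : ℝ) (u0 : ℝ → ℝ) (i : ℕ) (t : ℝ) : ℝ :=
  iteratedDeriv i (fun s => radauCoeff a b (fun y => u0 (y - s)) (k + 1)) t

/-- `w_i(x,t) = (h_j/2)^i G_i(t) F_i(x)` on the cell `(a,b)`. -/
noncomputable def wFun (k : ℕ) (a b : ℝ) (u0 : ℝ → ℝ) (F : ℕ → Polynomial ℝ)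
    (i : ℕ) (y t : ℝ) : ℝ :=
  ((b - a) / 2) ^ i * Gfun k a b u0 i t * (F i).eval y

/-- `w^l = Σ_{i=1}^l w_i` on the cell `(a,b)`. -/
noncomputable def wSum (k : ℕ) (a b : ℝ) (u0 : ℝ → ℝ) (F : ℕ → Polynomial ℝ)
    (l : ℕ) (y t : ℝ) : ℝ :=
  ∑ i ∈ Finset.Icc 1 l, wFun k a b u0 F i y t

/-- The interpolation function `u_I^l = P_h^- u - w^l` on the cell `(a,b)`;
here `P t` is the Gauss–Radau projection of `u(·,t)`. -/
noncomputable def uIl (k : ℕ) (a b : ℝ) (u0 : ℝ → ℝ) (P : ℝ → Polynomial ℝ)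
    (F : ℕ → Polynomial ℝ) (l : ℕ) (y t : ℝ) : ℝ :=
  (P t).eval y - wSum k a b u0 F l y t

/-- `uh` is a DG solution on `[0,T]` on the mesh `x 0 < x 1 < … < x N`
(the piece on the cell `τ_j = (x (j-1), x j)` is the polynomial `uh j t`),
with prescribed inflow value `inflow t` at the left boundary. -/
def IsDGSol (k N : ℕ) (x : ℕ → ℝ) (T : ℝ) (inflow : ℝ → ℝ)
    (uh : ℕ → ℝ → Polynomial ℝ) : Prop :=
  (∀ j ∈ Finset.Icc 1 N, ∀ t : ℝ, (uh j t).natDegree ≤ k) ∧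
  (∀ j ∈ Finset.Icc 1 N, ∀ y : ℝ, ContDiff ℝ 1 (fun t => (uh j t).eval y)) ∧
  (∀ j ∈ Finset.Icc 1 N, ∀ t ∈ Set.Icc (0:ℝ) T, ∀ v : Polynomial ℝ, v.natDegree ≤ k →
    (∫ y in (x (j-1))..(x j), deriv (fun s => (uh j s).eval y) t * v.eval y)
      - (∫ y in (x (j-1))..(x j), (uh j t).eval y * v.derivative.eval y)
      + (uh j t).eval (x j) * v.eval (x j)
      - (if j = 1 then inflow t else (uh (j-1) t).eval (x (j-1))) * v.eval (x (j-1)) = 0)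

/-- The error `u - u_I^l` on the cell `τ_j`, as a function of `(y, s)`. -/
noncomputable def errFun (k l : ℕ) (x : ℕ → ℝ) (u0 : ℝ → ℝ)
    (P : ℕ → ℝ → Polynomial ℝ) (F : ℕ → ℕ → Polynomial ℝ) (j : ℕ) (y s : ℝ) : ℝ :=
  u0 (y - s) - uIl k (x (j-1)) (x j) u0 (P j) (F j) l y s


open Polynomial in
noncomputable def Jp (a b : ℝ) : Polynomial ℝ →ₗ[ℝ] ℝ where
  toFun p := ∫ x in a..b, p.eval x
  map_add' p q := by
    simp only [Polynomial.eval_add]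
    exact intervalIntegral.integral_add (p.continuous.intervalIntegrable _ _)
      (q.continuous.intervalIntegrable _ _)
  map_smul' r p := by
    simp [Polynomial.eval_smul]

theorem Jp_apply (a b : ℝ) (p : Polynomial ℝ) : Jp a b p = ∫ x in a..b, p.eval x := rfl

theorem Jp_mul (a b : ℝ) (p q : Polynomial ℝ) :
    Jp a b (p * q) = ∫ x in a..b, p.eval x * q.eval x := by
  simp [Jp_apply]

theorem Jp_derivative (a b : ℝ) (p : Polynomial ℝ) :
    Jp a b (Polynomial.derivative p) = p.eval b - p.eval a := by
  rw [Jp_apply]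
  exact intervalIntegral.integral_eq_sub_of_hasDerivAt (fun x _ => p.hasDerivAt x)
    ((Polynomial.derivative p).continuous.intervalIntegrable _ _)

theorem Jp_parts (a b : ℝ) (p q : Polynomial ℝ) :
    Jp a b (Polynomial.derivative p * q) =
      p.eval b * q.eval b - p.eval a * q.eval a - Jp a b (p * Polynomial.derivative q) := by
  have := Jp_derivative a b (p * q)
  rw [Polynomial.derivative_mul, map_add] at this
  simp only [Polynomial.eval_mul] at this
  linarith

noncomputable def rodQ (m : ℕ) : Polynomial ℝ := (Polynomial.X ^ 2 - 1) ^ m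

noncomputable def legR (m : ℕ) : Polynomial ℝ :=
  Polynomial.C (1 / ((2:ℝ) ^ m * (Nat.factorial m : ℝ))) * Polynomial.derivative^[m] (rodQ m)

theorem iteratedDeriv_poly (m : ℕ) (p : Polynomial ℝ) :
    iteratedDeriv m (fun t => p.eval t) = fun t => (Polynomial.derivative^[m] p).eval t := by
  induction m with
  | zero => simp
  | succ n ih =>
    rw [iteratedDeriv_succ, ih]
    funext t
    rw [Polynomial.deriv, Function.iterate_succ_apply']

theorem legendreP_eq (m : ℕ) (s : ℝ) : legendreP m s = (legR m).eval s := by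
  unfold legendreP legR
  have h : (fun t : ℝ => (t ^ 2 - 1) ^ m) = fun t => (rodQ m).eval t := by
    funext t; simp [rodQ]
  rw [h, iteratedDeriv_poly]
  simp

theorem rodQ_fac (m : ℕ) : rodQ m =
    (Polynomial.X - Polynomial.C 1) ^ m * (Polynomial.X - Polynomial.C (-1)) ^ m := by
  rw [← mul_pow, rodQ]; congr 1; simp; ring

theorem rodQ_one (m i : ℕ) (hi : i < m) : (Polynomial.derivative^[i] (rodQ m)).eval 1 = 0 := by
  have := Polynomial.aeval_iterate_derivative_of_lt (rodQ m) m (1:ℝ)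
    (p' := (Polynomial.X - Polynomial.C (-1)) ^ m)
    (by rw [← rodQ_fac]; simp) hi
  simpa using this

theorem rodQ_neg_one (m i : ℕ) (hi : i < m) :
    (Polynomial.derivative^[i] (rodQ m)).eval (-1) = 0 := by
  have := Polynomial.aeval_iterate_derivative_of_lt (rodQ m) m (-1:ℝ)
    (p' := (Polynomial.X - Polynomial.C 1) ^ m)
    (by rw [mul_comm, ← rodQ_fac]; simp) hi
  simpa using this

theorem legR_one (m : ℕ) : (legR m).eval 1 = 1 := by
  have := Polynomial.aeval_iterate_derivative_self (rodQ m) m (1:ℝ)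
    (p' := (Polynomial.X - Polynomial.C (-1)) ^ m)
    (by rw [← rodQ_fac]; simp)
  simp only [Polynomial.aeval_def, Algebra.algebraMap_self, Polynomial.eval₂_id] at this
  rw [legR, Polynomial.eval_mul, this]
  have : (Nat.factorial m : ℝ) ≠ 0 := by positivity
  simp
  norm_num
  field_simp

theorem legR_neg_one (m : ℕ) : ((legR m).eval (-1))^2 = 1 := by
  have := Polynomial.aeval_iterate_derivative_self (rodQ m) m (-1:ℝ)
    (p' := (Polynomial.X - Polynomial.C 1) ^ m)
    (by rw [mul_comm, ← rodQ_fac]; simp)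
  simp only [Polynomial.aeval_def, Algebra.algebraMap_self, Polynomial.eval₂_id] at this
  rw [legR, Polynomial.eval_mul, this]
  have : (Nat.factorial m : ℝ) ≠ 0 := by positivity
  have h2 : ((-1 - 1 : ℝ)^m)^2 = (2^m)^2 := by
    rw [← pow_mul, ← pow_mul, mul_comm, pow_mul, pow_mul]; norm_num
  simp only [Polynomial.eval_C, Polynomial.eval_pow, Polynomial.eval_sub, Polynomial.eval_X,
    nsmul_eq_mul, mul_pow, h2]
  field_simp

theorem rodQ_orth (m i : ℕ) (hi : i ≤ m) (v : Polynomial ℝ) (hv : v.degree < i) :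
    Jp (-1) 1 (Polynomial.derivative^[i] (rodQ m) * v) = 0 := by
  induction i generalizing v with
  | zero =>
    have : v = 0 := by
      rw [← Polynomial.degree_eq_bot]
      simpa using hv
    simp [this]
  | succ n ih =>
    rw [Function.iterate_succ_apply', Jp_parts, rodQ_one m n (by omega), rodQ_neg_one m n (by omega),
      ih (by omega)]
    · simp
    · rw [Polynomial.degree_lt_iff_coeff_zero] at hv ⊢
      intro l hl
      rw [Polynomial.coeff_derivative, hv (l+1) (by omega)]; simp

theorem legR_orth (m : ℕ) (v : Polynomial ℝ) (hv : v.degree < m) :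
    Jp (-1) 1 (legR m * v) = 0 := by
  rw [legR, mul_assoc, ← Polynomial.smul_eq_C_mul, map_smul, rodQ_orth m m le_rfl v hv]; simp

theorem rodQ_natDegree (m : ℕ) : (rodQ m).natDegree = 2 * m := by
  rw [rodQ_fac, Polynomial.natDegree_mul] <;>
  first
  | exact pow_ne_zero _ (Polynomial.X_sub_C_ne_zero _)
  | (rw [Polynomial.natDegree_pow, Polynomial.natDegree_pow, Polynomial.natDegree_X_sub_C,
      Polynomial.natDegree_X_sub_C]; omega)

theorem rodQ_monic (m : ℕ) : (rodQ m).Monic := by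
  rw [rodQ_fac]
  exact ((Polynomial.monic_X_sub_C _).pow _).mul ((Polynomial.monic_X_sub_C _).pow _)

theorem legR_natDegree (m : ℕ) : (legR m).natDegree = m := by
  apply Polynomial.natDegree_eq_of_le_of_coeff_ne_zero
  · refine (Polynomial.natDegree_C_mul_le _ _).trans ?_
    refine (Polynomial.natDegree_iterate_derivative _ _).trans ?_
    rw [rodQ_natDegree]; omega
  · rw [legR, Polynomial.coeff_C_mul, Polynomial.coeff_iterate_derivative]
    have : (rodQ m).coeff (m + m) = 1 := by
      have := rodQ_monic m
      rw [Polynomial.Monic, Polynomial.leadingCoeff, rodQ_natDegree] at this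
      rw [← two_mul]; exact this
    rw [this]
    have h2 : ((m+m).descFactorial m : ℝ) ≠ 0 := by
      norm_cast
      intro h
      rw [Nat.descFactorial_eq_zero_iff_lt] at h; omega
    have : (Nat.factorial m : ℝ) ≠ 0 := by positivity
    simp [h2, this]

theorem legR_norm (m : ℕ) : Jp (-1) 1 (legR m * legR m) = 2 / (2 * m + 1) := by
  set L := legR m with hL
  have h1 : Jp (-1) 1 (L * (Polynomial.X * Polynomial.derivative L - Polynomial.C (m:ℝ) * L)) = 0 := by
    apply legR_orth
    rw [Polynomial.degree_lt_iff_coeff_zero]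
    intro l hl
    have hd := legR_natDegree m
    rcases l with _ | l
    · have : m = 0 := by omega
      subst this; simp
    · simp only [Polynomial.coeff_sub, Polynomial.coeff_X_mul, Polynomial.coeff_derivative,
        Polynomial.coeff_C_mul]
      rcases Nat.lt_or_ge m (l+1) with h | h
      · rw [Polynomial.coeff_eq_zero_of_natDegree_lt (by rw [hL, hd]; exact h)]; simp
      · have : m = l + 1 := by omega
        rw [this]; push_cast; ring
  have h2 := Jp_derivative (-1) 1 (Polynomial.X * (L * L))
  have h3 : Polynomial.derivative (Polynomial.X * (L * L)) =
      (2:ℝ) • (L * (Polynomial.X * Polynomial.derivative L - Polynomial.C (m:ℝ) * L))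
       + (2 * (m:ℝ) + 1) • (L * L) := by
    simp only [Polynomial.derivative_mul, Polynomial.derivative_X, Polynomial.smul_eq_C_mul,
      map_add, map_mul, Polynomial.C_ofNat, map_one]
    ring
  rw [h3, map_add, map_smul, map_smul, h1] at h2
  have h4 := legR_neg_one m
  have h5 := legR_one m
  simp only [Polynomial.eval_mul, Polynomial.eval_X, ← hL] at h2 h4 h5
  rw [h5] at h2
  have : (0:ℝ) < 2 * m + 1 := by positivity
  rw [eq_div_iff this.ne']
  simp only [smul_eq_mul] at h2
  linarith

theorem legR_bound (k : ℕ) : ∃ B : ℝ, 1 ≤ B ∧ ∀ l ≤ k, ∀ s ∈ Set.Icc (-1:ℝ) 1,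
    |(legR l).eval s| ≤ B := by
  have h : ∀ l : ℕ, ∃ B : ℝ, ∀ s ∈ Set.Icc (-1:ℝ) 1, |(legR l).eval s| ≤ B := fun l => by
    obtain ⟨B, hB⟩ := isCompact_Icc.exists_bound_of_continuousOn (s := Set.Icc (-1:ℝ) 1)
      (legR l).continuous.continuousOn
    exact ⟨B, hB⟩
  choose B hB using h
  have hp : ∀ l, 0 ≤ B l := fun l => (abs_nonneg _).trans (hB l 0 (by constructor <;> norm_num))
  refine ⟨1 + ∑ l ∈ Finset.range (k+1), B l, ?_, ?_⟩
  · linarith [Finset.sum_nonneg (s := Finset.range (k+1)) (fun l _ => hp l)]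
  · intro l hl s hs
    have := Finset.single_le_sum (f := B) (fun l _ => hp l)
      (Finset.mem_range.2 (Nat.lt_succ_of_le hl))
    linarith [hB l s hs]

/-- affine map as polynomial -/
noncomputable def affP (a b : ℝ) : Polynomial ℝ :=
  Polynomial.C (2 / (b - a)) * Polynomial.X + Polynomial.C (-(a + b) / (b - a))

theorem affP_eval (a b x : ℝ) : (affP a b).eval x = (2 * x - (a + b)) / (b - a) := by
  simp [affP]; ring

noncomputable def legC (a b : ℝ) (m : ℕ) : Polynomial ℝ := (legR m).comp (affP a b)

theorem legC_eval (a b : ℝ) (m : ℕ) (x : ℝ) : (legC a b m).eval x = legendreCell m a b x := by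
  rw [legC, Polynomial.eval_comp, affP_eval, legendreCell, legendreP_eq]

theorem affP_natDegree {a b : ℝ} (h : a < b) : (affP a b).natDegree = 1 :=
  Polynomial.natDegree_linear (by have := sub_pos.2 h; positivity)

theorem Jp_comp {a b : ℝ} (h : a < b) (p : Polynomial ℝ) :
    Jp a b (p.comp (affP a b)) = (b - a) / 2 * Jp (-1) 1 p := by
  have hp := sub_pos.2 h
  have hne := hp.ne'
  simp only [Jp_apply, Polynomial.eval_comp]
  have e : ∀ x, (affP a b).eval x = (2/(b-a)) * x + (-(a + b) / (b - a)) := by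
    intro x; simp [affP]
  simp only [e]
  rw [intervalIntegral.integral_comp_mul_add (fun x => p.eval x) (by positivity)]
  have e1 : (2/(b-a)) * a + (-(a + b) / (b - a)) = -1 := by field_simp; ring
  have e2 : (2/(b-a)) * b + (-(a + b) / (b - a)) = 1 := by field_simp; ring
  rw [e1, e2]
  simp

theorem legC_natDegree {a b : ℝ} (h : a < b) (m : ℕ) : (legC a b m).natDegree = m := by
  rw [legC, Polynomial.natDegree_comp, affP_natDegree h, legR_natDegree, mul_one]

theorem legC_orth {a b : ℝ} (h : a < b) (m : ℕ) (v : Polynomial ℝ) (hv : v.degree < m) :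
    Jp a b (legC a b m * v) = 0 := by
  have hp := sub_pos.2 h
  have hne := hp.ne'
  set A' : Polynomial ℝ := Polynomial.C ((b-a)/2) * Polynomial.X + Polynomial.C ((a+b)/2)
  have hA : A'.comp (affP a b) = Polynomial.X := by
    apply Polynomial.funext
    intro x
    simp only [Polynomial.eval_comp, affP_eval, A']
    simp
    field_simp
    ring
  have hv' : v = (v.comp A').comp (affP a b) := by
    rw [Polynomial.comp_assoc, hA, Polynomial.comp_X]
  have hd : (v.comp A').degree < m := by
    rcases eq_or_ne v 0 with h0 | h0
    · subst h0; simpa using hv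
    · refine lt_of_le_of_lt Polynomial.degree_le_natDegree ?_
      rw [Polynomial.natDegree_comp, Polynomial.natDegree_linear (by positivity), mul_one,
        ← Polynomial.degree_eq_natDegree h0]
      exact hv
  rw [hv', legC, ← Polynomial.mul_comp, Jp_comp h, legR_orth _ _ hd, mul_zero]

theorem legC_norm {a b : ℝ} (h : a < b) (m : ℕ) :
    Jp a b (legC a b m * legC a b m) = (b - a) / (2 * m + 1) := by
  rw [legC, ← Polynomial.mul_comp, Jp_comp h, legR_norm]
  ring

theorem legC_right {a b : ℝ} (h : a < b) (m : ℕ) : (legC a b m).eval b = 1 := by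
  have hp := sub_pos.2 h
  rw [legC, Polynomial.eval_comp, affP_eval]
  rw [show (2 * b - (a + b)) / (b - a) = 1 by rw [div_eq_one_iff_eq hp.ne']; ring, legR_one]

theorem legC_bound {a b : ℝ} (h : a < b) {k : ℕ} {B : ℝ}
    (hB : ∀ l ≤ k, ∀ s ∈ Set.Icc (-1:ℝ) 1, |(legR l).eval s| ≤ B) (l : ℕ) (hl : l ≤ k)
    (y : ℝ) (hy : y ∈ Set.Icc a b) : |(legC a b l).eval y| ≤ B := by
  have hp := sub_pos.2 h
  rw [legC, Polynomial.eval_comp, affP_eval]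
  apply hB l hl
  obtain ⟨h1, h2⟩ := hy
  constructor
  · rw [le_div_iff₀ hp]; linarith
  · rw [div_le_iff₀ hp]; linarith

theorem legC_orth' {a b : ℝ} (h : a < b) (l m : ℕ) (hlm : l ≠ m) :
    Jp a b (legC a b l * legC a b m) = 0 := by
  have key : ∀ l m : ℕ, m < l → Jp a b (legC a b l * legC a b m) = 0 := by
    intro l m hlm
    apply legC_orth h
    refine lt_of_le_of_lt Polynomial.degree_le_natDegree ?_
    rw [legC_natDegree h]; exact_mod_cast hlm
  rcases lt_or_gt_of_ne hlm with h1 | h1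
  · rw [mul_comm]; exact key _ _ h1
  · exact key _ _ h1

theorem legC_span {a b : ℝ} (h : a < b) (k : ℕ) (v : Polynomial ℝ) (hv : v.natDegree ≤ k) :
    ∃ α : ℕ → ℝ, v = ∑ l ∈ Finset.range (k+1), α l • legC a b l := by
  induction k generalizing v with
  | zero =>
    refine ⟨fun _ => v.coeff 0 / (legC a b 0).coeff 0, ?_⟩
    have h1 := Polynomial.eq_C_of_natDegree_le_zero hv
    have h2 := Polynomial.eq_C_of_natDegree_le_zero (legC_natDegree h 0).le
    have h3 : (legC a b 0).coeff 0 ≠ 0 := by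
      intro h0
      have := legC_right h 0
      rw [h2, h0] at this
      simp at this
    simp only [zero_add, Finset.range_one, Finset.sum_singleton]
    conv_lhs => rw [h1]
    conv_rhs => rw [h2]
    rw [Polynomial.smul_C]
    simp [h3]
  | succ k ih =>
    have hne : (legC a b (k+1)).coeff (k+1) ≠ 0 := by
      have := legC_natDegree h (k+1)
      have h0 : legC a b (k+1) ≠ 0 := by
        intro h0; rw [h0] at this; simp at this
      have h1 := Polynomial.leadingCoeff_ne_zero.2 h0
      rwa [Polynomial.leadingCoeff, this] at h1
    set β := v.coeff (k+1) / (legC a b (k+1)).coeff (k+1)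
    obtain ⟨α, hα⟩ := ih (v - β • legC a b (k+1)) (by
      rw [Polynomial.natDegree_le_iff_coeff_eq_zero]
      intro n hn
      rw [Polynomial.coeff_sub, Polynomial.coeff_smul]
      rcases Nat.lt_or_ge (k+1) n with h1 | h1
      · rw [Polynomial.coeff_eq_zero_of_natDegree_lt (lt_of_le_of_lt hv h1),
          Polynomial.coeff_eq_zero_of_natDegree_lt (by rw [legC_natDegree h]; exact h1)]
        simp
      · have : n = k + 1 := by omega
        subst this
        simp [β, hne])
    refine ⟨fun l => if l = k + 1 then β else α l, ?_⟩
    rw [Finset.sum_range_succ]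
    have : ∑ l ∈ Finset.range (k+1), (if l = k + 1 then β else α l) • legC a b l
        = ∑ l ∈ Finset.range (k+1), α l • legC a b l := by
      apply Finset.sum_congr rfl
      intro l hl
      rw [Finset.mem_range] at hl
      rw [if_neg (by omega)]
    rw [this, ← hα]
    simp

theorem legC_expand {a b : ℝ} (h : a < b) (k : ℕ) (v : Polynomial ℝ) (hv : v.natDegree ≤ k) :
    v = ∑ l ∈ Finset.range (k+1),
      ((2 * (l:ℝ) + 1) / (b - a) * Jp a b (legC a b l * v)) • legC a b l := by
  obtain ⟨α, hα⟩ := legC_span h k v hv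
  have hp := sub_pos.2 h
  conv_lhs => rw [hα]
  apply Finset.sum_congr rfl
  intro l hl
  congr 1
  have : Jp a b (legC a b l * v) = α l * ((b - a) / (2 * l + 1)) := by
    conv_lhs => rw [hα]
    rw [Finset.mul_sum, map_sum, Finset.sum_eq_single l]
    · rw [mul_smul_comm, map_smul, legC_norm h]; rfl
    · intro m _ hm
      rw [mul_smul_comm, map_smul, legC_orth' h _ _ hm.symm]; simp
    · intro h1; exact absurd hl h1
  rw [this]
  have : (2 * (l:ℝ) + 1) ≠ 0 := by positivity
  field_simp


/-- integration against a continuous function as a linear functional -/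
noncomputable def Iu (a b : ℝ) (u : ℝ → ℝ) (hu : Continuous u) : Polynomial ℝ →ₗ[ℝ] ℝ where
  toFun p := ∫ x in a..b, u x * p.eval x
  map_add' p q := by
    simp only [Polynomial.eval_add, mul_add]
    exact intervalIntegral.integral_add ((hu.mul p.continuous).intervalIntegrable _ _)
      ((hu.mul q.continuous).intervalIntegrable _ _)
  map_smul' r p := by
    simp only [Polynomial.eval_smul, smul_eq_mul, RingHom.id_apply]
    rw [← intervalIntegral.integral_const_mul]
    congr 1; funext x; ring

theorem Iu_apply (a b : ℝ) (u : ℝ → ℝ) (hu : Continuous u) (p : Polynomial ℝ) :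
    Iu a b u hu p = ∫ x in a..b, u x * p.eval x := rfl

theorem int_bound {a b : ℝ} (h : a ≤ b) (f : ℝ → ℝ) (S : ℝ)
    (hS : ∀ x ∈ Set.Icc a b, |f x| ≤ S) : |∫ x in a..b, f x| ≤ S * (b - a) := by
  have := intervalIntegral.norm_integral_le_of_norm_le_const (a := a) (b := b) (f := f) (C := S)
    (by
      intro x hx
      rw [Set.uIoc_of_le h] at hx
      exact hS x ⟨hx.1.le, hx.2⟩)
  rwa [abs_of_nonneg (sub_nonneg.2 h)] at this

noncomputable def KP (a b : ℝ) (m : ℕ) : Polynomial ℝ :=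
  ∑ l ∈ Finset.range m, (2 * (l:ℝ) + 1) • legC a b l

theorem KP_eval (a b : ℝ) (m : ℕ) (x : ℝ) : (KP a b m).eval x =
    ∑ l ∈ Finset.range m, (2 * (l:ℝ) + 1) * legendreCell l a b x := by
  simp [KP, Polynomial.eval_finsetSum, legC_eval]

theorem radau_eq (a b : ℝ) (w : ℝ → ℝ) (m : ℕ) :
    radauCoeff a b w m = w b - (1 / (b - a)) * ∫ x in a..b, w x * (KP a b m).eval x := by
  simp only [radauCoeff, KP_eval]

theorem KP_repro {a b : ℝ} (h : a < b) (k : ℕ) (v : Polynomial ℝ) (hv : v.natDegree ≤ k) :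
    Jp a b (KP a b (k+1) * v) = (b - a) * v.eval b := by
  have hp := sub_pos.2 h
  have h1 := congrArg (fun p => Polynomial.eval b p) (legC_expand h k v hv)
  simp only [Polynomial.eval_finsetSum, Polynomial.eval_smul, legC_right h, smul_eq_mul,
    mul_one] at h1
  rw [h1, KP, Finset.sum_mul, map_sum, Finset.mul_sum]
  apply Finset.sum_congr rfl
  intro l _
  rw [smul_mul_assoc, map_smul, smul_eq_mul]
  field_simp

theorem gr_test {a b : ℝ} (h : a < b) (k : ℕ) (u : ℝ → ℝ) (hu : Continuous u)
    (P : Polynomial ℝ) (hP : IsGRProj k a b u P) (v : Polynomial ℝ) (hv : v.natDegree ≤ k) :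
    Jp a b (P * v) = (∫ x in a..b, u x * v.eval x)
      + radauCoeff a b u (k+1) * Jp a b (legC a b k * v) := by
  have hp := sub_pos.2 h
  obtain ⟨h1, h2, h3⟩ := hP
  set D : Polynomial ℝ →ₗ[ℝ] ℝ := (Jp a b).comp (LinearMap.mulLeft ℝ P) - Iu a b u hu with hD
  have hDa : ∀ v, D v = Jp a b (P * v) - ∫ x in a..b, u x * v.eval x := by
    intro v; simp [hD, Iu_apply]
  have hl : ∀ l < k, D (legC a b l) = 0 := by
    intro l hl
    rw [hDa, Jp_mul, h2 _ (by rw [legC_natDegree h]; omega), sub_self]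
  have hK : D (KP a b (k+1)) = (2 * (k:ℝ) + 1) * D (legC a b k) := by
    rw [KP, Finset.sum_range_succ, map_add, map_sum, Finset.sum_eq_zero, zero_add, map_smul]
    · rfl
    · intro l hl'
      rw [map_smul, hl l (Finset.mem_range.1 hl'), smul_zero]
  have hK2 : D (KP a b (k+1)) = (b - a) * radauCoeff a b u (k+1) := by
    rw [hDa, mul_comm, KP_repro h k P h1, h3, radau_eq]
    field_simp
  have hv2 : D v = (2 * (k:ℝ) + 1) / (b - a) * Jp a b (legC a b k * v) * D (legC a b k) := by
    conv_lhs => rw [legC_expand h k v hv]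
    rw [Finset.sum_range_succ, map_add, map_sum, Finset.sum_eq_zero, zero_add, map_smul]
    · rfl
    · intro l hl'
      rw [map_smul, hl l (Finset.mem_range.1 hl'), smul_zero]
  have : D v = radauCoeff a b u (k+1) * Jp a b (legC a b k * v) := by
    rw [hv2]
    have : (2 * (k:ℝ) + 1) * D (legC a b k) = (b - a) * radauCoeff a b u (k+1) := by
      rw [← hK, hK2]
    field_simp
    linear_combination Jp a b (legC a b k * v) * this
  rw [hDa] at this
  linarith

noncomputable def KB (k : ℕ) (B : ℝ) : ℝ := ∑ l ∈ Finset.range (k+1), (2 * (l:ℝ) + 1) * B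

theorem KB_nonneg (k : ℕ) (B : ℝ) (hB : 1 ≤ B) : 0 ≤ KB k B :=
  Finset.sum_nonneg (fun l _ => by positivity)

theorem KP_bound {a b : ℝ} (h : a < b) {k : ℕ} {B : ℝ}
    (hB : ∀ l ≤ k, ∀ s ∈ Set.Icc (-1:ℝ) 1, |(legR l).eval s| ≤ B)
    (y : ℝ) (hy : y ∈ Set.Icc a b) : |(KP a b (k+1)).eval y| ≤ KB k B := by
  rw [KP, Polynomial.eval_finsetSum, KB]
  refine (Finset.abs_sum_le_sum_abs _ _).trans (Finset.sum_le_sum ?_)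
  intro l hl
  rw [Polynomial.eval_smul, smul_eq_mul, abs_mul, abs_of_nonneg (by positivity)]
  exact mul_le_mul_of_nonneg_left
    (legC_bound h hB l (Nat.lt_succ_iff.1 (Finset.mem_range.1 hl)) y hy) (by positivity)

theorem radau_bound {a b : ℝ} (h : a < b) {k : ℕ} {B : ℝ}
    (hB : ∀ l ≤ k, ∀ s ∈ Set.Icc (-1:ℝ) 1, |(legR l).eval s| ≤ B) (hB1 : 1 ≤ B)
    (u : ℝ → ℝ) (S : ℝ) (hS : ∀ x ∈ Set.Icc a b, |u x| ≤ S) :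
    |radauCoeff a b u (k+1)| ≤ (1 + KB k B) * S := by
  have hp := sub_pos.2 h
  have hKB := KB_nonneg k B hB1
  have hS0 : 0 ≤ S := (abs_nonneg _).trans (hS a ⟨le_rfl, h.le⟩)
  rw [radau_eq]
  have h1 := hS b ⟨h.le, le_rfl⟩
  have h2 := int_bound h.le (fun x => u x * (KP a b (k+1)).eval x) (S * KB k B) (by
    intro x hx
    rw [abs_mul]
    exact mul_le_mul (hS x hx) (KP_bound h hB x hx) (abs_nonneg _) hS0)
  have h3 : |1 / (b - a) * ∫ x in a..b, u x * (KP a b (k+1)).eval x| ≤ S * KB k B := by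
    rw [abs_mul, abs_of_pos (by positivity), div_mul_eq_mul_div, one_mul, div_le_iff₀ hp]
    exact h2
  have := abs_sub (u b) (1 / (b - a) * ∫ x in a..b, u x * (KP a b (k+1)).eval x)
  linarith

noncomputable def CG (k : ℕ) (B : ℝ) : ℝ :=
  ∑ l ∈ Finset.range (k+1), (2 * (l:ℝ) + 1) * (B + (1 + KB k B) * (B * B)) * B

theorem CG_nonneg (k : ℕ) (B : ℝ) (hB : 1 ≤ B) : 0 ≤ CG k B := by
  have := KB_nonneg k B hB
  exact Finset.sum_nonneg (fun l _ => by positivity)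

theorem gr_bound {a b : ℝ} (h : a < b) {k : ℕ} {B : ℝ}
    (hB : ∀ l ≤ k, ∀ s ∈ Set.Icc (-1:ℝ) 1, |(legR l).eval s| ≤ B) (hB1 : 1 ≤ B)
    (u : ℝ → ℝ) (hu : Continuous u) (S : ℝ) (hS : ∀ x ∈ Set.Icc a b, |u x| ≤ S)
    (P : Polynomial ℝ) (hP : IsGRProj k a b u P) (y : ℝ) (hy : y ∈ Set.Icc a b) :
    |P.eval y| ≤ CG k B * S := by
  have hp := sub_pos.2 h
  have hKB := KB_nonneg k B hB1
  have hS0 : 0 ≤ S := (abs_nonneg _).trans (hS a ⟨le_rfl, h.le⟩)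
  have hc := radau_bound h hB hB1 u S hS
  rw [legC_expand h k P hP.1, Polynomial.eval_finsetSum, CG, Finset.sum_mul]
  refine (Finset.abs_sum_le_sum_abs _ _).trans (Finset.sum_le_sum ?_)
  intro l hl
  have hl' : l ≤ k := Nat.lt_succ_iff.1 (Finset.mem_range.1 hl)
  have hly := legC_bound h hB l hl' y hy
  have h1 := int_bound h.le (fun x => u x * (legC a b l).eval x) (S * B) (by
    intro x hx
    rw [abs_mul]
    exact mul_le_mul (hS x hx) (legC_bound h hB l hl' x hx) (abs_nonneg _) hS0)
  have h2 : |Jp a b (legC a b k * legC a b l)| ≤ B * B * (b - a) := by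
    rw [Jp_mul]
    apply int_bound h.le
    intro x hx
    rw [abs_mul]
    exact mul_le_mul (legC_bound h hB k le_rfl x hx) (legC_bound h hB l hl' x hx) (abs_nonneg _)
      (by positivity)
  have h3 : |Jp a b (legC a b l * P)| ≤ (S * B + (1 + KB k B) * S * (B * B)) * (b - a) := by
    rw [mul_comm, gr_test h k u hu P hP _ (by rw [legC_natDegree h]; exact hl')]
    refine (abs_add_le _ _).trans ?_
    rw [abs_mul, add_mul]
    refine add_le_add h1 ?_
    rw [mul_assoc]
    exact mul_le_mul hc h2 (abs_nonneg _) (by positivity)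
  rw [Polynomial.eval_smul, smul_eq_mul, abs_mul, abs_mul, abs_of_pos (by positivity)]
  have h4 : (2 * (l:ℝ) + 1) / (b - a) * |Jp a b (legC a b l * P)| ≤
      (2 * (l:ℝ) + 1) * (S * B + (1 + KB k B) * S * (B * B)) := by
    rw [div_mul_eq_mul_div, div_le_iff₀ hp, mul_assoc]
    exact mul_le_mul_of_nonneg_left h3 (by positivity)
  refine (mul_le_mul h4 hly (abs_nonneg _) (by positivity)).trans (le_of_eq ?_)
  ring

theorem Dinv_hasDeriv (a b : ℝ) (p : Polynomial ℝ) (x : ℝ) :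
    HasDerivAt (Dinv a b (fun x => p.eval x)) (2 / (b - a) * p.eval x) x := by
  unfold Dinv
  exact (intervalIntegral.integral_hasDerivAt_right (p.continuous.intervalIntegrable _ _)
    (p.continuous.stronglyMeasurableAtFilter _ _) p.continuous.continuousAt).const_mul _

theorem Dinv_cont (a b : ℝ) (p : Polynomial ℝ) : Continuous (Dinv a b (fun x => p.eval x)) :=
  continuous_iff_continuousAt.2 (fun x => (Dinv_hasDeriv a b p x).continuousAt)

theorem Dinv_left (a b : ℝ) (f : ℝ → ℝ) : Dinv a b f a = 0 := by simp [Dinv]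

theorem Dinv_right (a b : ℝ) (p : Polynomial ℝ) :
    Dinv a b (fun x => p.eval x) b = 2 / (b - a) * Jp a b p := by simp [Dinv, Jp_apply]

theorem Dinv_parts (a b : ℝ) (p v : Polynomial ℝ) :
    (∫ x in a..b, Dinv a b (fun x => p.eval x) x * (Polynomial.derivative v).eval x) =
      2 / (b - a) * Jp a b p * v.eval b - 2 / (b - a) * Jp a b (p * v) := by
  rw [intervalIntegral.integral_mul_deriv_eq_deriv_mul (u' := fun x => 2 / (b - a) * p.eval x)
    (v := fun x => v.eval x)
    (fun x _ => Dinv_hasDeriv a b p x) (fun x _ => v.hasDerivAt x)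
    ((continuous_const.mul p.continuous).intervalIntegrable _ _)
    ((Polynomial.derivative v).continuous.intervalIntegrable _ _), Dinv_left, Dinv_right,
    Jp_mul, ← intervalIntegral.integral_const_mul]
  simp [mul_assoc]

theorem exists_antideriv (v : Polynomial ℝ) : ∃ V : Polynomial ℝ,
    Polynomial.derivative V = v ∧ V.natDegree ≤ v.natDegree + 1 := by
  refine ⟨∑ n ∈ Finset.range (v.natDegree + 1),
    Polynomial.C (v.coeff n / (n + 1)) * Polynomial.X ^ (n+1), ?_, ?_⟩
  · rw [Polynomial.derivative_sum]
    conv_rhs => rw [v.as_sum_range_C_mul_X_pow]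
    apply Finset.sum_congr rfl
    intro n _
    rw [Polynomial.derivative_C_mul_X_pow]
    have : ((n:ℝ) + 1) ≠ 0 := by positivity
    simp [this]
  · apply Polynomial.natDegree_sum_le_of_forall_le
    intro n hn
    refine (Polynomial.natDegree_C_mul_X_pow_le _ _).trans ?_
    have := Finset.mem_range.1 hn
    omega

/-- uniform version of the correction sequence, `H 0 = -L_k`. -/
def IsH (k : ℕ) (a b : ℝ) (H : ℕ → Polynomial ℝ) : Prop :=
  H 0 = -legC a b k ∧
  ∀ i, IsGRProj k a b (Dinv a b (fun x => (H i).eval x)) (-(H (i+1)))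

theorem isH_of_isFSeq (k : ℕ) (a b : ℝ) (F : ℕ → Polynomial ℝ) (hF : IsFSeq k a b F) :
    IsH k a b (fun i => if i = 0 then -legC a b k else F i) := by
  refine ⟨by simp, ?_⟩
  intro i
  rcases i with _ | i
  · obtain ⟨h1, h2, h3⟩ := hF.1
    have e : Dinv a b (fun x => (-legC a b k).eval x) =
        fun x => - Dinv a b (legendreCell k a b) x := by
      funext x
      simp [Dinv, legC_eval]
    simp only [if_true, zero_add, one_ne_zero, if_false, e]
    refine ⟨by simpa using h1, ?_, by simp [h3]⟩
    intro v hv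
    simp [h2 v hv]
  · simpa using hF.2 (i+2) (by omega)

section H
variable {k : ℕ} {a b : ℝ} {H : ℕ → Polynomial ℝ}

theorem H_natDegree (h : a < b) (hH : IsH k a b H) (i : ℕ) : (H i).natDegree ≤ k := by
  rcases i with _ | i
  · rw [hH.1, Polynomial.natDegree_neg, legC_natDegree h]
  · have := (hH.2 i).1
    rwa [Polynomial.natDegree_neg] at this

theorem H_orth (h : a < b) (hH : IsH k a b H) (i : ℕ) (v : Polynomial ℝ)
    (hv : v.natDegree + i + 1 ≤ k) : Jp a b (H i * v) = 0 := by
  induction i generalizing v with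
  | zero =>
    rw [hH.1, neg_mul, map_neg, legC_orth h, neg_zero]
    refine lt_of_le_of_lt Polynomial.degree_le_natDegree ?_
    exact_mod_cast (by omega : v.natDegree < k)
  | succ i ih =>
    obtain ⟨V, hV, hd⟩ := exists_antideriv v
    have h1 := (hH.2 i).2.1 v (by omega)
    have h2 := ih V (by omega)
    have h3 := ih 1 (by simp; omega)
    rw [mul_one] at h3
    rw [← Jp_mul] at h1
    rw [← hV, Dinv_parts, h2, h3, hV, neg_mul, map_neg] at h1
    simp at h1
    exact h1

theorem H_deriv (h : a < b) (hH : IsH k a b H) (i : ℕ) (hi : i + 1 ≤ k) (v : Polynomial ℝ)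
    (hv : v.natDegree ≤ k) :
    (b - a) / 2 * Jp a b (H (i+1) * Polynomial.derivative v) = Jp a b (H i * v) := by
  have hp := sub_pos.2 h
  have hd := Polynomial.natDegree_derivative_le v
  have h1 := (hH.2 i).2.1 (Polynomial.derivative v) (by omega)
  have h3 := H_orth h hH i 1 (by simp; omega)
  rw [mul_one] at h3
  rw [← Jp_mul, Dinv_parts, h3, neg_mul, map_neg] at h1
  field_simp at h1 ⊢
  linarith

theorem H_end (h : a < b) (hH : IsH k a b H) (i : ℕ) (hi : i + 1 ≤ k) :
    (H (i+1)).eval b = 0 := by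
  have h1 := (hH.2 i).2.2
  have h3 := H_orth h hH i 1 (by simp; omega)
  rw [mul_one] at h3
  rw [Dinv_right, h3] at h1
  simpa using h1

theorem H_bound (h : a < b) (hH : IsH k a b H) {B : ℝ}
    (hB : ∀ l ≤ k, ∀ s ∈ Set.Icc (-1:ℝ) 1, |(legR l).eval s| ≤ B) (hB1 : 1 ≤ B)
    (i : ℕ) (y : ℝ) (hy : y ∈ Set.Icc a b) : |(H i).eval y| ≤ (2 * CG k B) ^ i * B := by
  have hp := sub_pos.2 h
  have hCG := CG_nonneg k B hB1
  induction i generalizing y with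
  | zero =>
    rw [hH.1, Polynomial.eval_neg, abs_neg, pow_zero, one_mul]
    exact legC_bound h hB k le_rfl y hy
  | succ i ih =>
    have h1 := gr_bound h hB hB1 _ (Dinv_cont a b (H i)) (2 * ((2 * CG k B) ^ i * B)) (by
      intro x hx
      have := int_bound hx.1 (fun x => (H i).eval x) ((2 * CG k B) ^ i * B)
        (fun z hz => ih z ⟨hz.1, hz.2.trans hx.2⟩)
      rw [Dinv, abs_mul, abs_of_pos (by positivity), div_mul_eq_mul_div, div_le_iff₀ hp, mul_assoc]
      refine mul_le_mul_of_nonneg_left (this.trans ?_) (by norm_num)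
      exact mul_le_mul_of_nonneg_left (by linarith [hx.2]) (by positivity)) _ (hH.2 i) y hy
    rw [Polynomial.eval_neg, abs_neg] at h1
    refine h1.trans (le_of_eq ?_)
    ring
end H

theorem radau_smooth {a b : ℝ} (h : a < b) {k : ℕ} {B : ℝ}
    (hB : ∀ l ≤ k, ∀ s ∈ Set.Icc (-1:ℝ) 1, |(legR l).eval s| ≤ B) (hB1 : 1 ≤ B)
    (w : ℝ → ℝ) (hw : ContDiff ℝ (k+1) w) (S : ℝ)
    (hS : ∀ x ∈ Set.Icc a b, |iteratedDeriv (k+1) w x| ≤ S) :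
    |radauCoeff a b w (k+1)| ≤ (1 + KB k B) * (S * (b - a) ^ (k+1)) := by
  have hp := sub_pos.2 h
  have hS0 : 0 ≤ S := (abs_nonneg _).trans (hS a ⟨le_rfl, h.le⟩)
  set p : Polynomial ℝ := ∑ i ∈ Finset.range (k+1),
    Polynomial.C ((Nat.factorial i : ℝ)⁻¹ * iteratedDerivWithin i w (Set.Icc a b) a) *
      (Polynomial.X - Polynomial.C a) ^ i with hpdef
  have hpe : ∀ x, p.eval x = taylorWithinEval w k (Set.Icc a b) a x := by
    intro x
    rw [taylor_within_apply, hpdef, Polynomial.eval_finsetSum]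
    apply Finset.sum_congr rfl
    intro i _
    simp
    ring
  have hpd : p.natDegree ≤ k := by
    apply Polynomial.natDegree_sum_le_of_forall_le
    intro i hi
    refine (Polynomial.natDegree_C_mul_le _ _).trans ?_
    rw [Polynomial.natDegree_pow, Polynomial.natDegree_X_sub_C]
    have := Finset.mem_range.1 hi
    omega
  have hrem : ∀ x ∈ Set.Icc a b, |w x - p.eval x| ≤ S * (b - a) ^ (k+1) := by
    intro x hx
    have h1 := taylor_mean_remainder_bound (C := S) h.le hw.contDiffOn hx (by
      intro y hy
      rw [iteratedDerivWithin_eq_iteratedDeriv (uniqueDiffOn_Icc h)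
        (by exact_mod_cast hw.contDiffAt) hy]
      exact hS y hy)
    rw [hpe]
    refine h1.trans ?_
    have h2 : (1:ℝ) ≤ (Nat.factorial k : ℝ) := by exact_mod_cast Nat.factorial_pos k
    have h3 : (x - a)^(k+1) ≤ (b-a)^(k+1) :=
      pow_le_pow_left₀ (by linarith [hx.1]) (by linarith [hx.2]) _
    have h4 : 0 ≤ (x-a)^(k+1) := pow_nonneg (by linarith [hx.1]) _
    refine (div_le_self (by positivity) h2).trans ?_
    exact mul_le_mul_of_nonneg_left h3 hS0
  have hc : radauCoeff a b w (k+1) = radauCoeff a b (fun x => w x - p.eval x) (k+1) := by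
    rw [radau_eq, radau_eq]
    have e : (∫ x in a..b, (w x - p.eval x) * (KP a b (k+1)).eval x) =
       (∫ x in a..b, w x * (KP a b (k+1)).eval x) - (b - a) * p.eval b := by
      rw [← KP_repro h k p hpd, Jp_mul, ← intervalIntegral.integral_sub]
      · congr 1; funext x; ring
      · exact (hw.continuous.mul (Polynomial.continuous _)).intervalIntegrable _ _
      · exact ((Polynomial.continuous _).mul (Polynomial.continuous _)).intervalIntegrable _ _
    rw [e]
    field_simp
    ring
  rw [hc]
  exact radau_bound h hB hB1 _ _ hrem


theorem shiftInt_hasDeriv (a b : ℝ) (f : ℝ → ℝ) (hf : ContDiff ℝ 1 f) (p : Polynomial ℝ) (t : ℝ) :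
    HasDerivAt (fun s => ∫ y in a..b, f (y - s) * p.eval y)
      (-(∫ y in a..b, deriv f (y - t) * p.eval y)) t := by
  have hd : Continuous (deriv f) := hf.continuous_deriv le_rfl
  have hcont : Continuous (fun z : ℝ × ℝ => -(deriv f (z.2 - z.1) * p.eval z.2)) :=
    ((hd.comp (continuous_snd.sub continuous_fst)).mul (p.continuous.comp continuous_snd)).neg
  obtain ⟨C, hC⟩ := (isCompact_Icc.prod isCompact_uIcc :
    IsCompact (Set.Icc (t-1) (t+1) ×ˢ Set.uIcc a b)).exists_bound_of_continuousOn hcont.continuousOn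
  have := (intervalIntegral.hasDerivAt_integral_of_dominated_loc_of_deriv_le (μ := volume)
    (F := fun s y => f (y - s) * p.eval y) (F' := fun s y => -(deriv f (y - s) * p.eval y))
    (a := a) (b := b) (x₀ := t) (s := Set.Icc (t-1) (t+1)) (bound := fun _ => C)
    (Icc_mem_nhds (by linarith) (by linarith))
    (Filter.Eventually.of_forall fun s =>
      ((hf.continuous.comp (continuous_id.sub continuous_const)).mul
        p.continuous).aestronglyMeasurable)
    (((hf.continuous.comp (continuous_id.sub continuous_const)).mul
        p.continuous).intervalIntegrable _ _)
    ((hd.comp (continuous_id.sub continuous_const)).mul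
        p.continuous).neg.aestronglyMeasurable
    (Filter.Eventually.of_forall fun y hy s hs =>
      hC (s, y) ⟨hs, Set.uIoc_subset_uIcc hy⟩)
    intervalIntegrable_const
    (Filter.Eventually.of_forall fun y hy s hs => by
      have h1 : HasDerivAt f (deriv f (y - s)) (y - s) :=
        (hf.differentiable one_ne_zero _).hasDerivAt
      have h2 : HasDerivAt (fun s : ℝ => y - s) (-1) s := by
        simpa using (hasDerivAt_id s).const_sub y
      exact ((h1.comp s h2).mul_const (p.eval y)).congr_deriv (by ring))).2
  rw [← intervalIntegral.integral_neg]
  exact this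

theorem shift_hasDeriv (f : ℝ → ℝ) (hf : ContDiff ℝ 1 f) (b t : ℝ) :
    HasDerivAt (fun s => f (b - s)) (-(deriv f (b - t))) t := by
  have h1 : HasDerivAt f (deriv f (b - t)) (b - t) :=
    (hf.differentiable one_ne_zero _).hasDerivAt
  have h2 : HasDerivAt (fun s : ℝ => b - s) (-1) t := by
    simpa using (hasDerivAt_id t).const_sub b
  exact (h1.comp t h2).congr_deriv (by ring)

theorem radau_shift_hasDeriv (a b : ℝ) (f : ℝ → ℝ) (hf : ContDiff ℝ 1 f) (m : ℕ) (t : ℝ) :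
    HasDerivAt (fun s => radauCoeff a b (fun y => f (y - s)) m)
      (-(radauCoeff a b (fun y => deriv f (y - t)) m)) t := by
  simp only [radau_eq]
  exact ((shift_hasDeriv f hf b t).fun_sub
    ((shiftInt_hasDeriv a b f hf (KP a b m) t).const_mul (1 / (b - a)))).congr_deriv (by ring)

theorem iterD_contDiff (u0 : ℝ → ℝ) (n m i : ℕ) (hu : ContDiff ℝ n u0) (h : m + i ≤ n) :
    ContDiff ℝ m (iteratedDeriv i u0) := by
  rw [iteratedDeriv_eq_iterate]
  apply ContDiff.iterate_deriv'
  exact hu.of_le (by exact_mod_cast h)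

theorem Gfun_eq (k n : ℕ) (a b : ℝ) (u0 : ℝ → ℝ) (hu : ContDiff ℝ n u0) (i : ℕ) (hi : i ≤ n) :
    Gfun k a b u0 i =
      fun t => (-1)^i * radauCoeff a b (fun y => iteratedDeriv i u0 (y - t)) (k+1) := by
  induction i with
  | zero => funext t; simp [Gfun]
  | succ i ih =>
    have ih := ih (by omega)
    funext t
    have h1 : Gfun k a b u0 (i+1) t = deriv (Gfun k a b u0 i) t := by
      unfold Gfun; rw [iteratedDeriv_succ]
    rw [h1, ih]
    have h2 := ((radau_shift_hasDeriv a b (iteratedDeriv i u0)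
      (iterD_contDiff u0 n 1 i hu (by omega)) (k+1) t).const_mul ((-1:ℝ)^i)).deriv
    rw [h2, iteratedDeriv_succ]
    ring

theorem Gfun_hasDeriv (k n : ℕ) (a b : ℝ) (u0 : ℝ → ℝ) (hu : ContDiff ℝ n u0) (i : ℕ)
    (hi : i + 1 ≤ n) (t : ℝ) : HasDerivAt (Gfun k a b u0 i) (Gfun k a b u0 (i+1) t) t := by
  rw [Gfun_eq k n a b u0 hu i (by omega), Gfun_eq k n a b u0 hu (i+1) hi]
  have h2 := ((radau_shift_hasDeriv a b (iteratedDeriv i u0)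
      (iterD_contDiff u0 n 1 i hu (by omega)) (k+1) t).const_mul ((-1:ℝ)^i))
  rw [iteratedDeriv_succ]
  exact h2.congr_deriv (by ring)

theorem Gfun_bound {a b : ℝ} (h : a < b) {k : ℕ} {B : ℝ}
    (hB : ∀ l ≤ k, ∀ s ∈ Set.Icc (-1:ℝ) 1, |(legR l).eval s| ≤ B) (hB1 : 1 ≤ B)
    (u0 : ℝ → ℝ) (hu : ContDiff ℝ (2*k+2 : ℕ) u0) (S t : ℝ)
    (hS : ∀ y ∈ Set.Icc (a-t) (b-t), |iteratedDeriv (2*k+2) u0 y| ≤ S) :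
    |Gfun k a b u0 (k+1) t| ≤ (1 + KB k B) * (S * (b - a) ^ (k+1)) := by
  rw [Gfun_eq k _ a b u0 hu (k+1) (by omega)]
  simp only [abs_mul, abs_pow, abs_neg, abs_one, one_pow, one_mul]
  have hc := iterD_contDiff u0 _ (k+1) (k+1) hu (by omega)
  apply radau_smooth h hB hB1
  · have := hc.comp (contDiff_id.sub (contDiff_const (c := t)))
    exact_mod_cast this
  · intro x hx
    have e : iteratedDeriv (k+1) (fun y => iteratedDeriv (k+1) u0 (y - t)) x
        = iteratedDeriv (2*k+2) u0 (x - t) := by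
      rw [iteratedDeriv_comp_sub_const]
      simp only [iteratedDeriv_eq_iterate]
      rw [show 2 * k + 2 = (k + 1) + (k + 1) by omega, Function.iterate_add_apply deriv (k+1) (k+1)]
    rw [e]
    exact hS _ ⟨by linarith [hx.1], by linarith [hx.2]⟩

theorem uh_hasDeriv (a b : ℝ) (k : ℕ) (p : ℝ → Polynomial ℝ) (hp : ∀ t, (p t).natDegree ≤ k)
    (hc : ∀ y : ℝ, ContDiff ℝ 1 (fun t => (p t).eval y)) (v : Polynomial ℝ) (t : ℝ) :
    HasDerivAt (fun s => Jp a b (p s * v))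
      (∫ y in a..b, deriv (fun s => (p s).eval y) t * v.eval y) t := by
  classical
  set nd : ℕ → ℝ := fun i => (i:ℝ)
  set s := Finset.range (k+1)
  have hinj : Set.InjOn nd s := fun i _ j _ hij => by simpa [nd] using hij
  have hLag : ∀ r, p r = ∑ i ∈ s, ((p r).eval (nd i)) • Lagrange.basis s nd i := by
    intro r
    have := Lagrange.eq_interpolate (f := p r) hinj (by
      refine lt_of_le_of_lt Polynomial.degree_le_natDegree ?_
      simp only [s, Finset.card_range]
      exact_mod_cast Nat.lt_succ_of_le (hp r))
    conv_lhs => rw [this]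
    rw [Lagrange.interpolate_apply]
    simp [Polynomial.smul_eq_C_mul]
  have hd : ∀ y, HasDerivAt (fun r => (p r).eval y) (deriv (fun r => (p r).eval y) t) t :=
    fun y => ((hc y).differentiable one_ne_zero t).hasDerivAt
  have hdy : ∀ y, deriv (fun r => (p r).eval y) t =
      (∑ i ∈ s, (deriv (fun r => (p r).eval (nd i)) t) • Lagrange.basis s nd i).eval y := by
    intro y
    have h1 : HasDerivAt (fun r => ∑ i ∈ s, (p r).eval (nd i) * (Lagrange.basis s nd i).eval y)
        (∑ i ∈ s, (deriv (fun r => (p r).eval (nd i)) t) * (Lagrange.basis s nd i).eval y) t :=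
      HasDerivAt.fun_sum fun i _ => (hd (nd i)).mul_const _
    have h2 : (fun r => ∑ i ∈ s, (p r).eval (nd i) * (Lagrange.basis s nd i).eval y)
        = fun r => (p r).eval y := by
      funext r
      conv_rhs => rw [hLag r]
      simp [Polynomial.eval_finsetSum]
    rw [h2] at h1
    rw [h1.deriv]
    simp [Polynomial.eval_finsetSum]
  have e0 : (fun y => deriv (fun s => (p s).eval y) t * v.eval y) = fun y =>
      (∑ i ∈ s, (deriv (fun r => (p r).eval (nd i)) t) • Lagrange.basis s nd i).eval y
        * v.eval y := by
    funext y; rw [hdy y]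
  rw [e0, ← Jp_mul, Finset.sum_mul, map_sum]
  have e : (fun r => Jp a b (p r * v)) = fun r => ∑ i ∈ s, (p r).eval (nd i) *
      Jp a b (Lagrange.basis s nd i * v) := by
    funext r
    conv_lhs => rw [hLag r]
    rw [Finset.sum_mul, map_sum]
    simp only [smul_mul_assoc, map_smul, smul_eq_mul]
  rw [e]
  simp only [smul_mul_assoc, map_smul, smul_eq_mul]
  exact HasDerivAt.fun_sum fun i _ => (hd (nd i)).mul_const _

/-- the interpolant as polynomial -/
noncomputable def UI (k : ℕ) (a b : ℝ) (u0 : ℝ → ℝ) (P : ℝ → Polynomial ℝ)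
    (H : ℕ → Polynomial ℝ) (t : ℝ) : Polynomial ℝ :=
  P t - ∑ i ∈ Finset.range k, (((b - a) / 2) ^ (i+1) * Gfun k a b u0 (i+1) t) • H (i+1)

theorem UI_end {k : ℕ} {a b : ℝ} (h : a < b) {u0 : ℝ → ℝ} {P : ℝ → Polynomial ℝ}
    {H : ℕ → Polynomial ℝ} (hH : IsH k a b H)
    (hP : ∀ t, IsGRProj k a b (fun y => u0 (y - t)) (P t)) (t : ℝ) :
    (UI k a b u0 P H t).eval b = u0 (b - t) := by
  rw [UI, Polynomial.eval_sub, (hP t).2.2, Polynomial.eval_finsetSum, Finset.sum_eq_zero, sub_zero]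
  intro i hi
  rw [Polynomial.eval_smul, H_end h hH i (by have := Finset.mem_range.1 hi; omega), smul_zero]

theorem UI_natDegree {k : ℕ} {a b : ℝ} (h : a < b) {u0 : ℝ → ℝ} {P : ℝ → Polynomial ℝ}
    {H : ℕ → Polynomial ℝ} (hH : IsH k a b H)
    (hP : ∀ t, IsGRProj k a b (fun y => u0 (y - t)) (P t)) (t : ℝ) :
    (UI k a b u0 P H t).natDegree ≤ k := by
  refine (Polynomial.natDegree_sub_le_of_le (hP t).1 (n := k) ?_).trans (max_self k).le
  apply Polynomial.natDegree_sum_le_of_forall_le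
  intro i _
  exact (Polynomial.natDegree_smul_le _ _).trans (H_natDegree h hH _)

theorem UI_test {k : ℕ} {a b : ℝ} (h : a < b) {u0 : ℝ → ℝ} {P : ℝ → Polynomial ℝ}
    {H : ℕ → Polynomial ℝ} (hH : IsH k a b H) (hu : Continuous u0)
    (hP : ∀ t, IsGRProj k a b (fun y => u0 (y - t)) (P t)) (t : ℝ)
    (v : Polynomial ℝ) (hv : v.natDegree ≤ k) :
    Jp a b (UI k a b u0 P H t * v) = (∫ y in a..b, u0 (y - t) * v.eval y)
      - ∑ i ∈ Finset.range (k+1), ((b - a) / 2) ^ i * Gfun k a b u0 i t * Jp a b (H i * v) := by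
  rw [UI, sub_mul, map_sub, gr_test h k (fun y => u0 (y - t)) (by fun_prop) _ (hP t) v hv,
    Finset.sum_range_succ', Finset.sum_mul, map_sum]
  simp only [smul_mul_assoc, map_smul, smul_eq_mul, hH.1, neg_mul, map_neg]
  have h0 : Gfun k a b u0 0 t = radauCoeff a b (fun y => u0 (y - t)) (k+1) := by simp [Gfun]
  rw [h0]
  ring

theorem UI_hasDeriv {k : ℕ} {a b : ℝ} (h : a < b) {u0 : ℝ → ℝ} {P : ℝ → Polynomial ℝ}
    {H : ℕ → Polynomial ℝ} (hk : 1 ≤ k) (hH : IsH k a b H) (hu : ContDiff ℝ (2*k+2 : ℕ) u0)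
    (hP : ∀ t, IsGRProj k a b (fun y => u0 (y - t)) (P t)) (t : ℝ)
    (v : Polynomial ℝ) (hv : v.natDegree ≤ k) :
    HasDerivAt (fun s => Jp a b (UI k a b u0 P H s * v))
      (Jp a b (UI k a b u0 P H t * Polynomial.derivative v) - u0 (b - t) * v.eval b
        + u0 (a - t) * v.eval a
        - ((b - a) / 2) ^ k * Gfun k a b u0 (k+1) t * Jp a b (H k * v)) t := by
  have hu1 : ContDiff ℝ 1 u0 := hu.of_le (by exact_mod_cast (by omega : 1 ≤ 2*k+2))
  have hvd : (Polynomial.derivative v).natDegree ≤ k :=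
    (Polynomial.natDegree_derivative_le v).trans (by omega)
  have hvd' : (Polynomial.derivative v).natDegree + 0 + 1 ≤ k := by
    have := Polynomial.natDegree_derivative_le v; omega
  simp only [UI_test h hH hu.continuous hP _ v hv, UI_test h hH hu.continuous hP _ _ hvd]
  have h1 := (shiftInt_hasDeriv a b u0 hu1 v t).fun_sub
    (HasDerivAt.fun_sum (u := Finset.range (k+1)) (fun i hi =>
      ((Gfun_hasDeriv k _ a b u0 hu i (by have := Finset.mem_range.1 hi; omega) t).const_mul
        (((b - a) / 2) ^ i)).mul_const (Jp a b (H i * v))))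
  refine h1.congr_deriv ?_
  have hparts : (∫ y in a..b, u0 (y - t) * (Polynomial.derivative v).eval y) =
      u0 (b - t) * v.eval b - u0 (a - t) * v.eval a - ∫ y in a..b, deriv u0 (y - t) * v.eval y := by
    rw [intervalIntegral.integral_mul_deriv_eq_deriv_mul (u := fun y => u0 (y - t))
      (v := fun y => v.eval y)
      (u' := fun y => deriv u0 (y - t)) (fun x _ => ?_) (fun x _ => v.hasDerivAt x)
      (((hu1.continuous_deriv le_rfl).comp
        (continuous_id.sub continuous_const)).intervalIntegrable _ _)
      ((Polynomial.derivative v).continuous.intervalIntegrable _ _)]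
    have h3 : HasDerivAt u0 (deriv u0 (x - t)) (x - t) :=
      (hu1.differentiable one_ne_zero _).hasDerivAt
    exact h3.comp_sub_const x t
  rw [hparts, Finset.sum_range_succ (fun i => ((b - a) / 2) ^ i *
    Gfun k a b u0 (i+1) t * Jp a b (H i * v)), Finset.sum_range_succ', H_orth h hH 0 _ hvd']
  have : ∑ i ∈ Finset.range k, ((b - a) / 2) ^ (i+1) * Gfun k a b u0 (i+1) t *
      Jp a b (H (i+1) * Polynomial.derivative v) =
      ∑ i ∈ Finset.range k, ((b - a) / 2) ^ i * Gfun k a b u0 (i+1) t * Jp a b (H i * v) := by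
    apply Finset.sum_congr rfl
    intro i hi
    rw [← H_deriv h hH i (by have := Finset.mem_range.1 hi; omega) v hv]
    ring
  rw [this]
  ring

/-- energy derivative for a path of polynomials tested weakly -/
theorem energy_hasDeriv {a b : ℝ} (h : a < b) (k : ℕ) (p : ℝ → Polynomial ℝ)
    (hp : ∀ t, (p t).natDegree ≤ k) (t : ℝ) (R : Polynomial ℝ →ₗ[ℝ] ℝ)
    (hR : ∀ v : Polynomial ℝ, v.natDegree ≤ k → HasDerivAt (fun s => Jp a b (p s * v)) (R v) t) :
    HasDerivAt (fun s => Jp a b (p s * p s)) (2 * R (p t)) t := by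
  have e : (fun s => Jp a b (p s * p s)) = fun s => ∑ l ∈ Finset.range (k+1),
      (2 * (l:ℝ) + 1) / (b - a) * (Jp a b (p s * legC a b l))^2 := by
    funext s
    have h1 := congrArg (fun q => Jp a b (q * p s)) (legC_expand h k (p s) (hp s))
    simp only [Finset.sum_mul, map_sum] at h1
    rw [h1]
    apply Finset.sum_congr rfl
    intro l _
    rw [smul_mul_assoc, map_smul, smul_eq_mul, mul_comm (legC a b l)]
    ring
  have e2 : R (p t) = ∑ l ∈ Finset.range (k+1),
      (2 * (l:ℝ) + 1) / (b - a) * Jp a b (p t * legC a b l) * R (legC a b l) := by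
    conv_lhs => rw [legC_expand h k (p t) (hp t), map_sum]
    apply Finset.sum_congr rfl
    intro l _
    rw [map_smul, smul_eq_mul, mul_comm (legC a b l)]
  rw [e, e2, Finset.mul_sum]
  apply HasDerivAt.fun_sum
  intro l hl
  have := ((hR (legC a b l) (by
    rw [legC_natDegree h]; exact Nat.lt_succ_iff.1 (Finset.mem_range.1 hl))).fun_pow 2).const_mul
    ((2 * (l:ℝ) + 1) / (b - a))
  refine this.congr_deriv ?_
  push_cast
  ring


theorem Jp_sq_nonneg {a b : ℝ} (h : a ≤ b) (p : Polynomial ℝ) : 0 ≤ Jp a b (p * p) := by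
  rw [Jp_mul]
  exact intervalIntegral.integral_nonneg h fun x _ => mul_self_nonneg _

theorem Jp_cs {a b : ℝ} (h : a ≤ b) (q p : Polynomial ℝ) (S : ℝ) (hS0 : 0 ≤ S)
    (hS : ∀ y ∈ Set.Icc a b, |q.eval y| ≤ S) :
    |Jp a b (q * p)| ≤ S * (Real.sqrt (b - a) * Real.sqrt (Jp a b (p * p))) := by
  have hq : Jp a b (q * q) ≤ S ^ 2 * (b - a) := by
    rw [Jp_mul]
    refine (le_abs_self _).trans (int_bound h _ _ fun y hy => ?_)
    rw [abs_mul, sq]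
    exact mul_self_le_mul_self (abs_nonneg _) (hS y hy)
  have hd : discrim (Jp a b (q * q)) (2 * Jp a b (q * p)) (Jp a b (p * p)) ≤ 0 := by
    apply discrim_le_zero
    intro s
    have := Jp_sq_nonneg h (s • q + p)
    have e : (s • q + p) * (s • q + p) = (s * s) • (q * q) + (2 * s) • (q * p) + p * p := by
      simp only [Polynomial.smul_eq_C_mul, map_mul, map_ofNat]
      ring
    rw [e] at this
    simp only [map_add, map_smul, smul_eq_mul] at this
    linarith
  have hp := Jp_sq_nonneg h p
  have h2 : Jp a b (q * p) ^ 2 ≤ S ^ 2 * (b - a) * Jp a b (p * p) := by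
    rw [discrim] at hd
    nlinarith [mul_le_mul_of_nonneg_right hq hp]
  apply abs_le_of_sq_le_sq _ (by positivity)
  rw [mul_pow, mul_pow, Real.sq_sqrt (by linarith), Real.sq_sqrt hp]
  linarith

theorem uIl_eq (k : ℕ) (a b : ℝ) (u0 : ℝ → ℝ) (P : ℝ → Polynomial ℝ) (F : ℕ → Polynomial ℝ)
    (y t : ℝ) :
    (UI k a b u0 P (fun i => if i = 0 then -legC a b k else F i) t).eval y
      = uIl k a b u0 P F k y t := by
  rw [UI, uIl, wSum, Polynomial.eval_sub, Polynomial.eval_finsetSum]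
  congr 1
  rw [Finset.range_eq_Ico, ← Finset.Ico_add_one_right_eq_Icc,
    ← Finset.sum_Ico_add' (fun i => wFun k a b u0 F i y t) 0 k 1]
  simp [wFun]

theorem sqrt_gronwall (E D : ℝ → ℝ) (T K : ℝ) (hK : 0 ≤ K) (hE : ∀ t, 0 ≤ E t)
    (hD : ∀ t ∈ Set.Icc 0 T, HasDerivAt E (D t) t)
    (hb : ∀ t ∈ Set.Icc 0 T, D t ≤ 2 * K * Real.sqrt (E t)) (t : ℝ) (ht : t ∈ Set.Icc 0 T) :
    Real.sqrt (E t) ≤ Real.sqrt (E 0) + K * t := by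
  apply le_of_forall_pos_le_add
  intro ε hε
  have hder : ∀ s ∈ Set.Icc 0 T, HasDerivAt (fun s => Real.sqrt (E s + ε^2) - K * s)
      (D s / (2 * Real.sqrt (E s + ε^2)) - K * 1) s := by
    intro s hs
    exact (((hD s hs).add_const (ε^2)).sqrt (by have := hE s; positivity)).fun_sub
      ((hasDerivAt_id s).const_mul K)
  have hanti : AntitoneOn (fun s => Real.sqrt (E s + ε^2) - K * s) (Set.Icc 0 T) := by
    apply antitoneOn_of_deriv_nonpos (convex_Icc 0 T)
    · exact fun s hs => (hder s hs).continuousAt.continuousWithinAt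
    · exact fun s hs => (hder s (interior_subset hs)).differentiableAt.differentiableWithinAt
    · intro s hs
      have hs' := interior_subset hs
      rw [(hder s hs').deriv]
      have h1 := hE s
      have hpos : 0 < Real.sqrt (E s + ε^2) := Real.sqrt_pos.2 (by positivity)
      have hle : Real.sqrt (E s) ≤ Real.sqrt (E s + ε^2) := Real.sqrt_le_sqrt (by nlinarith)
      have := hb s hs'
      rw [mul_one, sub_nonpos, div_le_iff₀ (by positivity)]
      nlinarith [mul_le_mul_of_nonneg_left hle hK]
  have h0 : (0:ℝ) ∈ Set.Icc 0 T := ⟨le_rfl, ht.1.trans ht.2⟩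
  have := hanti h0 ht ht.1
  simp only [mul_zero, sub_zero] at this
  have h1 : Real.sqrt (E t) ≤ Real.sqrt (E t + ε^2) := Real.sqrt_le_sqrt (by nlinarith)
  have h2 : Real.sqrt (E 0 + ε^2) ≤ Real.sqrt (E 0) + ε := by
    have := Real.sq_sqrt (hE 0)
    rw [Real.sqrt_le_left (by positivity)]
    nlinarith [mul_nonneg (Real.sqrt_nonneg (E 0)) hε.le]
  linarith

theorem tele (N : ℕ) (e : ℝ) (q : ℕ → ℝ) (hN : 1 ≤ N) :
    ∑ j ∈ Finset.Icc 1 N, ((if j = 1 then e else q (j-1)) ^ 2 - q j ^ 2) = e ^ 2 - q N ^ 2 := by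
  induction N, hN using Nat.le_induction with
  | base => simp
  | succ n hn ih =>
    rw [Finset.sum_Icc_succ_top (by omega), ih, if_neg (by omega)]
    simp

theorem tele' (N : ℕ) (x : ℕ → ℝ) :
    ∑ j ∈ Finset.Icc 1 N, (x j - x (j-1)) = x N - x 0 := by
  induction N with
  | zero => simp
  | succ n ih =>
    rw [Finset.sum_Icc_succ_top (by omega), ih]
    simp

theorem node_bound {a b : ℝ} (h : a < b) {k : ℕ} {B : ℝ}
    (hB : ∀ l ≤ k, ∀ s ∈ Set.Icc (-1:ℝ) 1, |(legR l).eval s| ≤ B) (hB1 : 1 ≤ B)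
    (p : Polynomial ℝ) (hp : p.natDegree ≤ k) :
    (b - a) * p.eval b ^ 2 ≤ KB k B ^ 2 * Jp a b (p * p) := by
  have h1 := KP_repro h k p hp
  have h2 := Jp_cs h.le (KP a b (k+1)) p (KB k B) (KB_nonneg k B hB1) (KP_bound h hB)
  rw [h1] at h2
  have h3 := sq_le_sq' (by have := neg_abs_le ((b-a) * p.eval b); linarith) ((le_abs_self _).trans h2)
  have hJ := Jp_sq_nonneg h.le p
  rw [mul_pow, mul_pow, mul_pow, Real.sq_sqrt (by linarith), Real.sq_sqrt hJ] at h3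
  have hba : 0 < b - a := by linarith
  refine le_of_mul_le_mul_left ?_ hba
  nlinarith

/-- constant in the consistency estimate -/
noncomputable def CC (k : ℕ) (B : ℝ) : ℝ := (1 + KB k B) * ((2 * CG k B) ^ k * B)

theorem CC_nonneg (k : ℕ) (B : ℝ) (hB1 : 1 ≤ B) : 0 ≤ CC k B := by
  have := KB_nonneg k B hB1
  have := CG_nonneg k B hB1
  unfold CC
  positivity

theorem rho_bound {k : ℕ} {a b : ℝ} (h : a < b) {u0 : ℝ → ℝ} {B : ℝ}
    (hB : ∀ l ≤ k, ∀ s ∈ Set.Icc (-1:ℝ) 1, |(legR l).eval s| ≤ B) (hB1 : 1 ≤ B)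
    {H : ℕ → Polynomial ℝ} (hH : IsH k a b H) (hu : ContDiff ℝ (2*k+2 : ℕ) u0) (M hh t : ℝ)
    (hM0 : 0 ≤ M) (hhh : b - a ≤ hh)
    (hM : ∀ y ∈ Set.Icc (a-t) (b-t), |iteratedDeriv (2*k+2) u0 y| ≤ M) (p : Polynomial ℝ) :
    |((b - a) / 2) ^ k * Gfun k a b u0 (k+1) t * Jp a b (H k * p)| ≤
      CC k B * hh ^ (2*k+1) * M * (Real.sqrt (b - a) * Real.sqrt (Jp a b (p * p))) := by
  have hKB := KB_nonneg k B hB1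
  have hCG := CG_nonneg k B hB1
  have hba : 0 < b - a := by linarith
  have h1 := Gfun_bound h hB hB1 u0 hu M t hM
  have h2 := Jp_cs h.le (H k) p ((2 * CG k B) ^ k * B) (by positivity) (H_bound h hH hB hB1 k)
  have h3 : |((b - a) / 2) ^ k| ≤ hh ^ k := by
    rw [abs_of_nonneg (by positivity)]
    exact pow_le_pow_left₀ (by positivity) (by linarith) k
  have h4 : |Gfun k a b u0 (k+1) t| ≤ (1 + KB k B) * (M * hh ^ (k+1)) := h1.trans (by gcongr)
  rw [abs_mul, abs_mul]
  have hh0 : 0 ≤ hh := by linarith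
  calc _ ≤ hh ^ k * ((1 + KB k B) * (M * hh ^ (k+1))) *
        ((2 * CG k B) ^ k * B * (Real.sqrt (b - a) * Real.sqrt (Jp a b (p * p)))) := by gcongr
    _ = _ := by unfold CC; ring

theorem R_bound {a b : ℝ} (p : Polynomial ℝ) (e ρ : ℝ) :
    Jp a b (p * Polynomial.derivative p) - p.eval b * p.eval b + e * p.eval a - ρ
      ≤ 1/2 * (e ^ 2 - p.eval b ^ 2) + |ρ| := by
  have h1 := Jp_parts a b p p
  rw [mul_comm (Polynomial.derivative p)] at h1
  nlinarith [neg_abs_le ρ, sq_nonneg (e - p.eval a)]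


theorem cell_energy {k : ℕ} {a b : ℝ} (h : a < b) {u0 : ℝ → ℝ} {P : ℝ → Polynomial ℝ}
    {H : ℕ → Polynomial ℝ} (hk : 1 ≤ k) (hH : IsH k a b H) (hu : ContDiff ℝ (2*k+2 : ℕ) u0)
    (hP : ∀ t, IsGRProj k a b (fun y => u0 (y - t)) (P t)) (t : ℝ)
    (uh : ℝ → Polynomial ℝ) (hd : ∀ s, (uh s).natDegree ≤ k)
    (hc : ∀ y : ℝ, ContDiff ℝ 1 (fun s => (uh s).eval y)) (g : ℝ)
    (hdg : ∀ v : Polynomial ℝ, v.natDegree ≤ k →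
      (∫ y in a..b, deriv (fun s => (uh s).eval y) t * v.eval y)
      - (∫ y in a..b, (uh t).eval y * v.derivative.eval y)
      + (uh t).eval b * v.eval b - g * v.eval a = 0)
    (p : ℝ → Polynomial ℝ) (hp : p = fun s => UI k a b u0 P H s - uh s) :
    HasDerivAt (fun s => Jp a b (p s * p s))
      (2 * (Jp a b (p t * Polynomial.derivative (p t)) - (p t).eval b * (p t).eval b
        + (u0 (a - t) - g) * (p t).eval a
        - ((b - a) / 2) ^ k * Gfun k a b u0 (k+1) t * Jp a b (H k * p t))) t := by
  have hpe : (p t).eval b = u0 (b - t) - (uh t).eval b := by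
    rw [hp]; simp [UI_end h hH hP t]
  have hpd : ∀ s, (p s).natDegree ≤ k := by
    intro s
    rw [hp]
    exact (Polynomial.natDegree_sub_le_of_le (UI_natDegree h hH hP s) (hd s)).trans
      (max_self k).le
  have key := energy_hasDeriv h k p hpd t
    (Jp a b ∘ₗ LinearMap.mulLeft ℝ (p t) ∘ₗ Polynomial.derivative
      - (p t).eval b • Polynomial.leval b + (u0 (a - t) - g) • Polynomial.leval a
      - (((b - a) / 2) ^ k * Gfun k a b u0 (k+1) t) • (Jp a b ∘ₗ LinearMap.mulLeft ℝ (H k))) ?_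
  · refine key.congr_deriv ?_
    simp [Polynomial.leval]
  · intro v hv
    have h1 := (UI_hasDeriv h hk hH hu hP t v hv).fun_sub (uh_hasDeriv a b k uh hd hc v t)
    have e : (fun s => Jp a b (UI k a b u0 P H s * v) - Jp a b (uh s * v))
        = fun s => Jp a b (p s * v) := by
      funext s
      rw [hp, ← map_sub, ← sub_mul]
    rw [e] at h1
    refine h1.congr_deriv ?_
    have h2 := hdg v hv
    rw [← Jp_mul] at h2
    have h3 : Jp a b (p t * Polynomial.derivative v) = Jp a b (UI k a b u0 P H t *
        Polynomial.derivative v) - Jp a b (uh t * Polynomial.derivative v) := by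
      rw [hp, ← map_sub, ← sub_mul]
    simp only [LinearMap.sub_apply, LinearMap.add_apply, LinearMap.comp_apply,
      LinearMap.smul_apply, LinearMap.mulLeft_apply, Polynomial.leval_apply, smul_eq_mul, h3, hpe]
    linarith

theorem mesh_bounds (N : ℕ) (x : ℕ → ℝ) (hx : ∀ j < N, x j < x (j+1)) :
    ∀ j ≤ N, x 0 ≤ x j ∧ x j ≤ x N := by
  have h1 : ∀ j ≤ N, x 0 ≤ x j := by
    intro j
    induction j with
    | zero => intro _; exact le_rfl
    | succ n ih => intro hn; exact (ih (by omega)).trans (hx n (by omega)).le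
  have h2 : ∀ d ≤ N, x (N - d) ≤ x N := by
    intro d
    induction d with
    | zero => intro _; exact le_rfl
    | succ n ih =>
      intro hn
      have := hx (N - (n+1)) (by omega)
      rw [show N - (n+1) + 1 = N - n by omega] at this
      exact this.le.trans (ih (by omega))
  intro j hj
  refine ⟨h1 j hj, ?_⟩
  have := h2 (N - j) (by omega)
  rwa [show N - (N - j) = j by omega] at this

theorem energy_main (k : ℕ) (hk : 1 ≤ k) (B : ℝ) (hB1 : 1 ≤ B)
    (hB : ∀ l ≤ k, ∀ s ∈ Set.Icc (-1:ℝ) 1, |(legR l).eval s| ≤ B)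
    (N : ℕ) (x : ℕ → ℝ) (h T : ℝ) (hN : 1 ≤ N) (hx0 : x 0 = 0) (hxN : x N = 2 * Real.pi)
    (hx : ∀ j < N, x j < x (j+1)) (hh : ∀ j ∈ Finset.Icc 1 N, x j - x (j-1) ≤ h)
    (u0 : ℝ → ℝ) (hu : ContDiff ℝ (2*k+2 : ℕ) u0) (M : ℝ) (hM0 : 0 ≤ M)
    (hM : ∀ y ∈ Set.Icc (-T) (2 * Real.pi), |iteratedDeriv (2*k+2) u0 y| ≤ M)
    (P : ℕ → ℝ → Polynomial ℝ)
    (hP : ∀ j ∈ Finset.Icc 1 N, ∀ t : ℝ,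
            IsGRProj k (x (j-1)) (x j) (fun y => u0 (y - t)) (P j t))
    (H : ℕ → ℕ → Polynomial ℝ) (hH : ∀ j ∈ Finset.Icc 1 N, IsH k (x (j-1)) (x j) (H j))
    (inflow : ℝ → ℝ) (uh : ℕ → ℝ → Polynomial ℝ) (hdg : IsDGSol k N x T inflow uh)
    (hin : ((∀ t, inflow t = (uh N t).eval (x N)) ∧ (∀ y : ℝ, u0 (y + 2 * Real.pi) = u0 y))
            ∨ (∀ t, inflow t = u0 (-t)))
    (p : ℕ → ℝ → Polynomial ℝ)
    (hp : p = fun j s => UI k (x (j-1)) (x j) u0 (P j) (H j) s - uh j s)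
    (t : ℝ) (ht : t ∈ Set.Icc 0 T) :
    Real.sqrt (∑ j ∈ Finset.Icc 1 N, Jp (x (j-1)) (x j) (p j t * p j t)) ≤
      Real.sqrt (∑ j ∈ Finset.Icc 1 N, Jp (x (j-1)) (x j) (p j 0 * p j 0))
        + (CC k B * h ^ (2*k+1) * M * Real.sqrt (2 * Real.pi)) * t := by
  have hcell : ∀ j ∈ Finset.Icc 1 N, x (j-1) < x j := by
    intro j hj
    have hj := Finset.mem_Icc.1 hj
    have := hx (j-1) (by omega)
    rwa [show j - 1 + 1 = j by omega] at this
  have hmb := mesh_bounds N x hx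
  have hh0 : 0 ≤ h := by
    have h1 : 1 ∈ Finset.Icc 1 N := Finset.mem_Icc.2 ⟨le_rfl, hN⟩
    have := hcell 1 h1
    have := hh 1 h1
    linarith
  have hpe : ∀ j ∈ Finset.Icc 1 N, ∀ s, (p j s).eval (x j)
      = u0 (x j - s) - (uh j s).eval (x j) := by
    intro j hj s
    rw [hp]
    simp [UI_end (hcell j hj) (hH j hj) (hP j hj) s]
  set g : ℕ → ℝ → ℝ := fun j s => if j = 1 then inflow s else (uh (j-1) s).eval (x (j-1)) with hg
  set R : ℕ → ℝ → ℝ := fun j s =>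
      (Jp (x (j-1)) (x j) (p j s * Polynomial.derivative (p j s))
        - (p j s).eval (x j) * (p j s).eval (x j)
        + (u0 (x (j-1) - s) - g j s) * (p j s).eval (x (j-1))
        - ((x j - x (j-1)) / 2) ^ k * Gfun k (x (j-1)) (x j) u0 (k+1) s
          * Jp (x (j-1)) (x j) (H j k * p j s)) with hR
  have hK := CC_nonneg k B hB1
  refine sqrt_gronwall (fun s => ∑ j ∈ Finset.Icc 1 N, Jp (x (j-1)) (x j) (p j s * p j s))
    (fun s => ∑ j ∈ Finset.Icc 1 N, 2 * R j s) T
    (CC k B * h ^ (2*k+1) * M * Real.sqrt (2 * Real.pi)) (by positivity) ?_ ?_ ?_ t ht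
  · intro s
    exact Finset.sum_nonneg fun j hj => Jp_sq_nonneg (hcell j hj).le _
  · intro s hs
    apply HasDerivAt.fun_sum
    intro j hj
    exact cell_energy (hcell j hj) hk (hH j hj) hu (hP j hj) s (uh j) (hdg.1 j hj) (hdg.2.1 j hj)
      (g j s) (fun v hv => hdg.2.2 j hj s hs v hv) (p j) (by rw [hp])
  · intro s hs
    have hb : ∀ j ∈ Finset.Icc 1 N, R j s ≤
        1/2 * ((if j = 1 then u0 (-s) - inflow s else (p (j-1) s).eval (x (j-1))) ^ 2
          - (p j s).eval (x j) ^ 2)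
        + CC k B * h ^ (2*k+1) * M * (Real.sqrt (x j - x (j-1)) *
          Real.sqrt (Jp (x (j-1)) (x j) (p j s * p j s))) := by
      intro j hj
      have hj' := Finset.mem_Icc.1 hj
      have e : u0 (x (j-1) - s) - g j s =
          if j = 1 then u0 (-s) - inflow s else (p (j-1) s).eval (x (j-1)) := by
        simp only [hg]
        split_ifs with h1
        · subst h1; simp [hx0]
        · rw [hpe (j-1) (Finset.mem_Icc.2 (by omega))]
      simp only [hR]
      rw [e]
      refine (R_bound _ _ _).trans ?_
      refine add_le_add le_rfl (rho_bound (hcell j hj) hB hB1 (hH j hj) hu M h s hM0 (hh j hj) ?_ _)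
      intro y hy
      have h1 := (hmb (j-1) (by omega)).1
      have h2 := (hmb j (by omega)).2
      exact hM y ⟨by linarith [hy.1, hs.2], by linarith [hy.2, hs.1]⟩
    have hin2 : (u0 (-s) - inflow s) ^ 2 ≤ (p N s).eval (x N) ^ 2 := by
      rcases hin with ⟨h1, h2⟩ | h1
      · rw [h1, hpe N (Finset.mem_Icc.2 ⟨hN, le_rfl⟩), ← h2 (-s), hxN,
          show -s + 2 * Real.pi = 2 * Real.pi - s by ring]
      · rw [h1, sub_self, zero_pow two_ne_zero]; positivity
    have hsum := Finset.sum_le_sum hb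
    rw [Finset.sum_add_distrib, ← Finset.mul_sum, ← Finset.mul_sum,
      tele N (u0 (-s) - inflow s) (fun j => (p j s).eval (x j)) hN] at hsum
    have hcs : ∑ j ∈ Finset.Icc 1 N, (Real.sqrt (x j - x (j-1)) *
          Real.sqrt (Jp (x (j-1)) (x j) (p j s * p j s))) ≤ Real.sqrt (2 * Real.pi) *
          Real.sqrt (∑ j ∈ Finset.Icc 1 N, Jp (x (j-1)) (x j) (p j s * p j s)) := by
      refine (Real.sum_mul_le_sqrt_mul_sqrt _ _ _).trans (le_of_eq ?_)
      congr 2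
      · rw [← hxN, ← sub_zero (x N), ← hx0, ← tele' N x]
        exact Finset.sum_congr rfl fun j hj => Real.sq_sqrt (sub_pos.2 (hcell j hj)).le
      · exact Finset.sum_congr rfl fun j hj => Real.sq_sqrt (Jp_sq_nonneg (hcell j hj).le _)
    have hcs' := mul_le_mul_of_nonneg_left hcs
      (show 0 ≤ CC k B * h ^ (2*k+1) * M by positivity)
    rw [← Finset.mul_sum]
    linarith

/-- superconvergence at the downwind points: pointwise rate `2k+1/2` and
rate `2k+1` in the discrete-average sense, under the initial condition
`‖u_h(·,0) - u_I^k(·,0)‖₀ ≤ C₀ h^{2k+1} M_{2k+2}`. -/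
theorem stmt12 (k : ℕ) (hk : 1 ≤ k) (c : ℝ) (hc : 1 ≤ c) (C₀ : ℝ) :
    ∃ C : ℝ, 0 < C ∧
      ∀ (N : ℕ) (x : ℕ → ℝ) (h T : ℝ), 1 ≤ N → x 0 = 0 → x N = 2 * Real.pi →
        (∀ j < N, x j < x (j+1)) →
        (∀ j ∈ Finset.Icc 1 N, x j - x (j-1) ≤ h) →
        (∀ j ∈ Finset.Icc 1 N, h ≤ c * (x j - x (j-1))) →
        0 < T →
        ∀ u0 : ℝ → ℝ, ContDiff ℝ (2*k+2) u0 →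
        ∀ M : ℝ,
          (∀ i ≤ 2*k+2, ∀ y ∈ Set.Icc (-T) (2 * Real.pi), |iteratedDeriv i u0 y| ≤ M) →
        ∀ P : ℕ → ℝ → Polynomial ℝ,
          (∀ j ∈ Finset.Icc 1 N, ∀ t : ℝ,
            IsGRProj k (x (j-1)) (x j) (fun y => u0 (y - t)) (P j t)) →
        ∀ F : ℕ → ℕ → Polynomial ℝ,
          (∀ j ∈ Finset.Icc 1 N, IsFSeq k (x (j-1)) (x j) (F j)) →
        ∀ (inflow : ℝ → ℝ) (uh : ℕ → ℝ → Polynomial ℝ),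
          IsDGSol k N x T inflow uh →
          (((∀ t, inflow t = (uh N t).eval (x N))
              ∧ (∀ y : ℝ, u0 (y + 2 * Real.pi) = u0 y))
            ∨ (∀ t, inflow t = u0 (-t))) →
          Real.sqrt (∑ j ∈ Finset.Icc 1 N, ∫ y in (x (j-1))..(x j),
              ((uh j 0).eval y - uIl k (x (j-1)) (x j) u0 (P j) (F j) k y 0)^2)
            ≤ C₀ * h^(2*k+1) * M →
        ∀ t ∈ Set.Icc (0:ℝ) T,
          (∀ j ∈ Finset.Icc 1 N,
            |u0 (x j - t) - (uh j t).eval (x j)|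
              ≤ C * (1 + t) * h ^ (2*(k:ℝ) + 1/2) * M)
          ∧ Real.sqrt ((1/(N:ℝ)) * ∑ j ∈ Finset.Icc 1 N,
                (u0 (x j - t) - (uh j t).eval (x j))^2)
              ≤ C * (1 + t) * h^(2*k+1) * M := by
  obtain ⟨B, hB1, hB⟩ := legR_bound k
  have hKB := KB_nonneg k B hB1
  have hCC := CC_nonneg k B hB1
  set A : ℝ := |C₀| + CC k B * Real.sqrt (2 * Real.pi) with hA
  have hA0 : 0 ≤ A := by positivity
  refine ⟨KB k B * Real.sqrt c * A + 1, by positivity, ?_⟩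
  intro N x h T hN hx0 hxN hx hh hhc hT u0 hu' M hM P hP F hF inflow uh hdg hin hinit t ht
  have hu : ContDiff ℝ (2*k+2 : ℕ) u0 := by exact_mod_cast hu'
  have hpi := Real.pi_gt_three
  have hM0 : 0 ≤ M := (abs_nonneg _).trans (hM 0 (by omega) 0 ⟨by linarith, by linarith⟩)
  have hcell : ∀ j ∈ Finset.Icc 1 N, x (j-1) < x j := by
    intro j hj
    have hj := Finset.mem_Icc.1 hj
    have := hx (j-1) (by omega)
    rwa [show j - 1 + 1 = j by omega] at this
  have hh0 : 0 < h := by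
    have h1 : 1 ∈ Finset.Icc 1 N := Finset.mem_Icc.2 ⟨le_rfl, hN⟩
    have := hcell 1 h1
    have := hh 1 h1
    linarith
  have ht0 := ht.1
  set H : ℕ → ℕ → Polynomial ℝ := fun j i => if i = 0 then -legC (x (j-1)) (x j) k else F j i
    with hHdef
  have hH : ∀ j ∈ Finset.Icc 1 N, IsH k (x (j-1)) (x j) (H j) := fun j hj =>
    isH_of_isFSeq k _ _ _ (hF j hj)
  set p : ℕ → ℝ → Polynomial ℝ :=
    fun j s => UI k (x (j-1)) (x j) u0 (P j) (H j) s - uh j s with hp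
  have hmain := energy_main k hk B hB1 hB N x h T hN hx0 hxN hx hh u0 hu M hM0
    (hM (2*k+2) le_rfl) P hP H hH inflow uh hdg hin p hp t ht
  have hE0 : ∑ j ∈ Finset.Icc 1 N, Jp (x (j-1)) (x j) (p j 0 * p j 0) =
      ∑ j ∈ Finset.Icc 1 N, ∫ y in (x (j-1))..(x j),
              ((uh j 0).eval y - uIl k (x (j-1)) (x j) u0 (P j) (F j) k y 0)^2 := by
    apply Finset.sum_congr rfl
    intro j _
    rw [Jp_mul]
    congr 1
    funext y
    simp only [hp, Polynomial.eval_sub, hHdef, uIl_eq]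
    ring
  rw [hE0] at hmain
  set E : ℝ := ∑ j ∈ Finset.Icc 1 N, Jp (x (j-1)) (x j) (p j t * p j t) with hE
  have hEj : ∀ j ∈ Finset.Icc 1 N, 0 ≤ Jp (x (j-1)) (x j) (p j t * p j t) := fun j hj =>
    Jp_sq_nonneg (hcell j hj).le _
  have hEn : 0 ≤ E := Finset.sum_nonneg hEj
  have hpd : ∀ j ∈ Finset.Icc 1 N, (p j t).natDegree ≤ k := fun j hj =>
    (Polynomial.natDegree_sub_le_of_le (UI_natDegree (hcell j hj) (hH j hj) (hP j hj) t)
      (hdg.1 j hj t)).trans (max_self k).le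
  have hpe : ∀ j ∈ Finset.Icc 1 N, u0 (x j - t) - (uh j t).eval (x j) = (p j t).eval (x j) := by
    intro j hj
    simp [hp, UI_end (hcell j hj) (hH j hj) (hP j hj) t]
  have hsE : Real.sqrt E ≤ A * (1 + t) * h ^ (2*k+1) * M := by
    have hX : 0 ≤ h ^ (2*k+1) * M := by positivity
    have h1 : C₀ * h ^ (2*k+1) * M ≤ |C₀| * (h ^ (2*k+1) * M) := by
      rw [mul_assoc]; exact mul_le_mul_of_nonneg_right (le_abs_self _) hX
    have h2 : 0 ≤ |C₀| * (h ^ (2*k+1) * M) * t := by positivity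
    have h3 : 0 ≤ CC k B * Real.sqrt (2 * Real.pi) * (h ^ (2*k+1) * M) := by positivity
    rw [hA]
    linarith
  have hnode : ∀ j ∈ Finset.Icc 1 N, h * (p j t).eval (x j) ^ 2 ≤
      c * KB k B ^ 2 * Jp (x (j-1)) (x j) (p j t * p j t) := by
    intro j hj
    have h1 := node_bound (hcell j hj) hB hB1 (p j t) (hpd j hj)
    have h2 := mul_le_mul_of_nonneg_right (hhc j hj) (sq_nonneg ((p j t).eval (x j)))
    have h3 := mul_le_mul_of_nonneg_left h1 (by linarith : 0 ≤ c)
    linarith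
  have hfin : KB k B * Real.sqrt c * Real.sqrt E ≤
      (KB k B * Real.sqrt c * A + 1) * (1 + t) * h ^ (2*k+1) * M := by
    have h1 := mul_le_mul_of_nonneg_left hsE (by positivity : 0 ≤ KB k B * Real.sqrt c)
    have h2 : 0 ≤ (1 + t) * h ^ (2*k+1) * M := by positivity
    linarith
  constructor
  · intro j hj
    rw [hpe j hj]
    have h1 : h * (p j t).eval (x j) ^ 2 ≤ c * KB k B ^ 2 * E :=
      (hnode j hj).trans (mul_le_mul_of_nonneg_left
        (Finset.single_le_sum (f := fun j => Jp (x (j-1)) (x j) (p j t * p j t)) hEj hj)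
        (by positivity))
    have h2 : Real.sqrt h * |(p j t).eval (x j)| ≤ KB k B * Real.sqrt c * Real.sqrt E := by
      refine (sq_le_sq₀ (by positivity) (by positivity)).1 ?_
      rw [mul_pow, mul_pow, mul_pow, Real.sq_sqrt hh0.le, Real.sq_sqrt (by linarith),
        Real.sq_sqrt hEn, sq_abs]
      linarith
    have h3 : h ^ (2*k+1) = Real.sqrt h * h ^ (2*(k:ℝ) + 1/2) := by
      rw [Real.sqrt_eq_rpow, ← Real.rpow_add hh0, ← Real.rpow_natCast]
      congr 1
      push_cast
      ring
    have h4 : 0 < Real.sqrt h := Real.sqrt_pos.2 hh0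
    refine le_of_mul_le_mul_left ?_ h4
    refine (h2.trans hfin).trans (le_of_eq ?_)
    rw [h3]
    ring
  · refine le_trans ?_ hfin
    apply Real.sqrt_le_iff.2 ⟨by positivity, ?_⟩
    rw [mul_pow, mul_pow, Real.sq_sqrt (by linarith), Real.sq_sqrt hEn]
    have hN0 : (0:ℝ) < N := by exact_mod_cast hN
    have hNh : 1 ≤ N * h := by
      have h1 := Finset.sum_le_sum hh
      rw [tele', hxN, hx0] at h1
      simp at h1
      linarith
    have hs : h * ∑ j ∈ Finset.Icc 1 N, (u0 (x j - t) - (uh j t).eval (x j))^2 ≤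
        c * KB k B ^ 2 * E := by
      rw [hE, Finset.mul_sum, Finset.mul_sum]
      apply Finset.sum_le_sum
      intro j hj
      rw [hpe j hj]
      exact hnode j hj
    have hS0 : 0 ≤ ∑ j ∈ Finset.Icc 1 N, (u0 (x j - t) - (uh j t).eval (x j))^2 :=
      Finset.sum_nonneg fun j _ => sq_nonneg _
    rw [one_div, inv_mul_le_iff₀ hN0]
    have h5 := mul_le_mul_of_nonneg_left hs hN0.le
    have h6 := mul_le_mul_of_nonneg_right hNh hS0
    linarith
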